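/- If a Frobenius group FH with kernel F and complement H acts by linear transformations on a finite-dimensional vector space V over a field k in such a way that C_V(F) = 0 (no nonzero vector is fixed by all of F), then V is a free kH-module. -/

import Mathlib

/-- An element of a group is `p`-regular if its order is prime to `p`. -/
def IsPRegular {G : Type*} [Group G] (p : ℕ) (x : G) : Prop := (orderOf x).Coprime p

/-- A group is `p`-nilpotent if its `p`-regular elements are closed under multiplication; for
finite groups this says that they form a normal `p`-complement. -/
def IsPNilpotent (p : ℕ) (G : Type*) [Group G] : Prop :=
  ∀ x y : G, IsPRegular p x → IsPRegular p y → IsPRegular p (x * y)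

section Regular

variable {G H : Type*} [Group G] [Group H] {p : ℕ}

theorem isPRegular_of_pow_eq_one {x : G} {n : ℕ} (hn : n.Coprime p) (h : x ^ n = 1) :
    IsPRegular p x :=
  Nat.Coprime.coprime_dvd_left (orderOf_dvd_of_pow_eq_one h) hn

theorem isPRegular_one : IsPRegular p (1 : G) := by simp [IsPRegular]

theorem IsPRegular.inv {x : G} (h : IsPRegular p x) : IsPRegular p x⁻¹ := by
  simpa [IsPRegular] using h

theorem IsPRegular.map {x : G} (h : IsPRegular p x) (f : G →* H) : IsPRegular p (f x) :=
  Nat.Coprime.coprime_dvd_left (orderOf_map_dvd f x) h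

theorem isPRegular_map_iff {f : G →* H} (hf : Function.Injective f) {x : G} :
    IsPRegular p (f x) ↔ IsPRegular p x := by
  rw [IsPRegular, orderOf_injective f hf, IsPRegular]

theorem IsPRegular.conj {x : G} (h : IsPRegular p x) (g : G) : IsPRegular p (g * x * g⁻¹) :=
  h.map (MulAut.conj g).toMonoidHom

theorem isPRegular_coe {K : Subgroup G} {x : K} : IsPRegular p (x : G) ↔ IsPRegular p x :=
  isPRegular_map_iff (f := K.subtype) K.subtype_injective

theorem IsPRegular.eq_one_of_isPGroup (hp : p.Prime) (hG : IsPGroup p G) {x : G}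
    (hx : IsPRegular p x) : x = 1 := by
  have := Fact.mk hp
  obtain ⟨k, hk⟩ := IsPGroup.iff_orderOf.1 hG x
  rw [← orderOf_eq_one_iff]
  rw [IsPRegular, hk] at hx
  rw [hk]
  exact (Nat.coprime_self _).1 (Nat.Coprime.coprime_dvd_right (dvd_refl _)
    (Nat.Coprime.pow_right k hx))

theorem IsPRegular.eq_one_of_mem (hp : p.Prime) {P : Subgroup G} (hP : IsPGroup p P) {x : G}
    (hx : IsPRegular p x) (hxP : x ∈ P) : x = 1 := by
  have := IsPRegular.eq_one_of_isPGroup hp hP (x := ⟨x, hxP⟩) (isPRegular_coe.1 hx)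
  simpa using this

theorem isPGroup_of_isPRegular_eq_one [Finite G] (hp : p.Prime)
    (h : ∀ x : G, IsPRegular p x → x = 1) : IsPGroup p G := by
  intro x
  refine ⟨(orderOf x).factorization p, h _ ?_⟩
  refine isPRegular_of_pow_eq_one (n := orderOf x / p ^ (orderOf x).factorization p) ?_ ?_
  · exact (Nat.coprime_ordCompl hp (orderOf_pos x).ne').symm
  · rw [← pow_mul, Nat.mul_div_cancel' (Nat.ordProj_dvd _ _), pow_orderOf_eq_one]

theorem IsPRegular.exists_lift [Finite G] (hp : p.Prime) {f : G →* H}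
    (hf : Function.Surjective f) {y : H} (hy : IsPRegular p y) :
    ∃ x : G, IsPRegular p x ∧ f x = y := by
  obtain ⟨x, rfl⟩ := hf y
  set a := (orderOf x).factorization p
  have hc : (p ^ a).Coprime (orderOf (f x)) := (Nat.Coprime.pow_right a hy).symm
  obtain ⟨u, hu⟩ := exists_pow_eq_self_of_coprime hc
  refine ⟨x ^ (p ^ a * u), ?_, ?_⟩
  · refine isPRegular_of_pow_eq_one (n := orderOf x / p ^ a) ?_ ?_
    · exact (Nat.coprime_ordCompl hp (orderOf_pos x).ne').symm
    · rw [← pow_mul, mul_comm _ u, mul_assoc, Nat.mul_div_cancel' (Nat.ordProj_dvd _ _),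
        mul_comm, pow_mul, pow_orderOf_eq_one, one_pow]
  · rw [map_pow, pow_mul, hu]

theorem isPRegular_of_mk (M : Subgroup G) [M.Normal] (hM : ∀ x ∈ M, IsPRegular p x) {x : G}
    (hx : IsPRegular p (x : G ⧸ M)) : IsPRegular p x := by
  have h1 : x ^ orderOf (x : G ⧸ M) ∈ M := by
    rw [← QuotientGroup.eq_one_iff, QuotientGroup.mk_pow, pow_orderOf_eq_one]
  refine isPRegular_of_pow_eq_one
    (n := orderOf (x : G ⧸ M) * orderOf (x ^ orderOf (x : G ⧸ M))) ?_ ?_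
  · exact Nat.Coprime.mul_left hx (hM _ h1)
  · rw [pow_mul, pow_orderOf_eq_one]

theorem IsPNilpotent.of_injective (h : IsPNilpotent p H) {f : G →* H}
    (hf : Function.Injective f) : IsPNilpotent p G := by
  intro x y hx hy
  rw [← isPRegular_map_iff hf, map_mul]
  exact h _ _ (hx.map f) (hy.map f)

theorem IsPNilpotent.mono {K L : Subgroup G} (h : IsPNilpotent p L) (hKL : K ≤ L) :
    IsPNilpotent p K :=
  h.of_injective (Subgroup.inclusion_injective hKL)

theorem IsPNilpotent.of_surjective [Finite G] (hp : p.Prime) (h : IsPNilpotent p G) {f : G →* H}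
    (hf : Function.Surjective f) : IsPNilpotent p H := by
  intro x y hx hy
  obtain ⟨x, hx', rfl⟩ := hx.exists_lift hp hf
  obtain ⟨y, hy', rfl⟩ := hy.exists_lift hp hf
  rw [← map_mul]
  exact (h _ _ hx' hy').map f

theorem IsPNilpotent.of_quotient_regular (M : Subgroup G) [M.Normal]
    (hM : ∀ x ∈ M, IsPRegular p x) (h : IsPNilpotent p (G ⧸ M)) : IsPNilpotent p G :=
  fun x y hx hy => isPRegular_of_mk M hM
    (h x y (hx.map (QuotientGroup.mk' M)) (hy.map (QuotientGroup.mk' M)))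

theorem isPNilpotent_of_isPGroup_quotient (hp : p.Prime) (K : Subgroup G) [K.Normal]
    (hK : IsPNilpotent p K) (h : IsPGroup p (G ⧸ K)) : IsPNilpotent p G := by
  have key : ∀ x : G, IsPRegular p x → x ∈ K := fun x hx => by
    rw [← QuotientGroup.eq_one_iff]
    exact (hx.map (QuotientGroup.mk' K)).eq_one_of_isPGroup hp h
  intro x y hx hy
  exact isPRegular_coe.2 (hK ⟨x, key x hx⟩ ⟨y, key y hy⟩ (isPRegular_coe.1 hx)
    (isPRegular_coe.1 hy))

/-- The normal `p`-complement of a `p`-nilpotent group. -/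
def IsPNilpotent.complement (h : IsPNilpotent p G) : Subgroup G where
  carrier := {x | IsPRegular p x}
  mul_mem' hx hy := h _ _ hx hy
  one_mem' := isPRegular_one
  inv_mem' hx := IsPRegular.inv hx

theorem IsPNilpotent.mem_complement (h : IsPNilpotent p G) {x : G} :
    x ∈ h.complement ↔ IsPRegular p x := Iff.rfl

instance (h : IsPNilpotent p G) : h.complement.Normal :=
  ⟨fun _ hx g => IsPRegular.conj hx g⟩

theorem IsPNilpotent.isPGroup_quotient [Finite G] (hp : p.Prime) (h : IsPNilpotent p G) :
    IsPGroup p (G ⧸ h.complement) := by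
  refine isPGroup_of_isPRegular_eq_one hp fun x hx => ?_
  obtain ⟨x, hx', rfl⟩ := hx.exists_lift hp (QuotientGroup.mk'_surjective h.complement)
  exact (QuotientGroup.eq_one_iff x).2 hx'

theorem IsPNilpotent.exists_mul_eq [Finite G] [hp : Fact p.Prime] (h : IsPNilpotent p G)
    (T : Sylow p G) (n : G) : ∃ k, IsPRegular p k ∧ ∃ t ∈ T, k * t = n := by
  have htop : h.complement ⊔ T = ⊤ := by
    rw [← Subgroup.index_eq_one]
    obtain ⟨k, hk⟩ := IsPGroup.iff_card.1 (h.isPGroup_quotient hp.out)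
    have h1 : (h.complement ⊔ T).index ∣ p ^ k := by
      rw [← hk]; exact Subgroup.index_dvd_of_le le_sup_left
    have h2 : (h.complement ⊔ T).index ∣ (T : Subgroup G).index :=
      Subgroup.index_dvd_of_le le_sup_right
    have h3 : (p ^ k).Coprime (T : Subgroup G).index :=
      Nat.Coprime.pow_left k ((Nat.Prime.coprime_iff_not_dvd hp.out).2 T.not_dvd_index)
    exact Nat.eq_one_of_dvd_coprimes h3 h1 h2
  have := htop ▸ Subgroup.mem_top n
  rw [Subgroup.mem_sup_of_normal_left] at this
  obtain ⟨k, hk, t, ht, e⟩ := this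
  exact ⟨k, hk, t, ht, e⟩

/-- In a `p`-nilpotent group, `p`-regular elements centralize normal `p`-subgroups. -/
theorem IsPNilpotent.commute (hp : p.Prime) (h : IsPNilpotent p G) {X : Subgroup G} [hX : X.Normal]
    (hXp : IsPGroup p X) {x y : G} (hx : x ∈ X) (hy : IsPRegular p y) : Commute x y := by
  have h1 : IsPRegular p (x * y * x⁻¹ * y⁻¹) := h _ _ (hy.conj x) hy.inv
  have h2 : x * y * x⁻¹ * y⁻¹ ∈ X := by
    have := X.mul_mem hx (hX.conj_mem _ (X.inv_mem hx) y)
    simpa [mul_assoc] using this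
  have h3 := h1.eq_one_of_mem hp hXp h2
  rw [mul_inv_eq_one, mul_inv_eq_iff_eq_mul] at h3
  exact h3

theorem IsPNilpotent.commute_of_normalizer (hp : p.Prime) {X : Subgroup G}
    (h : IsPNilpotent p (Subgroup.normalizer (X : Set G))) (hXp : IsPGroup p X) {x y : G}
    (hx : x ∈ X) (hy : IsPRegular p y) (hyX : y ∈ Subgroup.normalizer (X : Set G)) :
    Commute x y := by
  have hX : IsPGroup p (X.subgroupOf (Subgroup.normalizer (X : Set G))) :=
    hXp.comap_of_injective _ (Subgroup.subtype_injective _)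
  have := h.commute hp hX (x := ⟨x, Subgroup.le_normalizer hx⟩) (y := ⟨y, hyX⟩)
    (by simpa [Subgroup.mem_subgroupOf] using hx) (isPRegular_coe.1 hy)
  simpa [Commute, SemiconjBy, Subtype.ext_iff] using this

theorem isPNilpotent_subgroup_iff {K : Subgroup G} : IsPNilpotent p K ↔
    ∀ x ∈ K, ∀ y ∈ K, IsPRegular p x → IsPRegular p y → IsPRegular p (x * y) := by
  constructor
  · intro h x hx y hy h1 h2
    exact isPRegular_coe.2 (h ⟨x, hx⟩ ⟨y, hy⟩ (isPRegular_coe.1 h1) (isPRegular_coe.1 h2))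
  · intro h x y h1 h2
    exact isPRegular_coe.1 (h x x.2 y y.2 (isPRegular_coe.2 h1) (isPRegular_coe.2 h2))

end Regular

section Frobenius

variable {G : Type*} [Group G] {p : ℕ}

open scoped Pointwise commutatorElement

theorem IsPGroup.exists_mem_normalizer_notMem [Finite G] [hp : Fact p.Prime] {P D : Subgroup G}
    (hP : IsPGroup p P) (h : D < P) :
    ∃ y ∈ P, y ∈ Subgroup.normalizer (D : Set G) ∧ y ∉ D := by
  have := hP.isNilpotent
  have h1 : D.subgroupOf P < ⊤ := by
    rw [lt_top_iff_ne_top, Ne, Subgroup.subgroupOf_eq_top]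
    exact h.not_ge
  obtain ⟨y, hy, hyD⟩ := SetLike.exists_of_lt
    (Group.normalizerCondition_of_isNilpotent (G := P) (D.subgroupOf P) h1)
  refine ⟨y, y.2, ?_, fun hyD' => hyD hyD'⟩
  rw [Subgroup.mem_normalizer_iff] at hy ⊢
  intro g
  constructor
  · intro hg
    exact (hy ⟨g, h.le hg⟩).1 hg
  · intro hg
    have hgP : g ∈ P := by
      have := P.mul_mem (P.mul_mem (P.inv_mem y.2) (h.le hg)) y.2
      simpa [mul_assoc] using this
    exact (hy ⟨g, hgP⟩).2 hg

/-- If all normalizers of nontrivial `p`-subgroups are `p`-nilpotent, then any two Sylow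
`p`-subgroups are conjugate by an element centralizing their intersection. -/
theorem Sylow.exists_centralizer_smul_eq [Finite G] [hp : Fact p.Prime]
    (H : ∀ X : Subgroup G, IsPGroup p X → X ≠ ⊥ →
      IsPNilpotent p (Subgroup.normalizer (X : Set G))) (P S : Sylow p G) :
    ∃ c : G, (∀ x ∈ P, x ∈ S → Commute c x) ∧ c • S = P := by
  induction hn : Nat.card G - Nat.card (P ⊓ S : Subgroup G) using Nat.strong_induction_on
    generalizing P S with
  | _ n ih =>
  subst hn
  have card_step : ∀ (D E : Subgroup G), D < E → Nat.card G - Nat.card E <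
      Nat.card G - Nat.card D := by
    intro D E h
    have h1 : Nat.card D < Nat.card E := Set.ncard_lt_ncard h
    have h2 := Subgroup.card_le_card_group E
    omega
  by_cases hPS : P = S
  · exact ⟨1, fun _ _ _ => Commute.one_left _, by simp [hPS]⟩
  set D : Subgroup G := P ⊓ S with hD
  by_cases hbot : D = ⊥
  · obtain ⟨c, hc⟩ := MulAction.exists_smul_eq G S P
    refine ⟨c, fun x hx hx' => ?_, hc⟩
    have : x ∈ D := ⟨hx, hx'⟩
    rw [hbot, Subgroup.mem_bot] at this
    rw [this]; exact Commute.one_right _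
  have hDp : IsPGroup p D := P.isPGroup'.to_le inf_le_left
  have hN := H D hDp hbot
  set N := Subgroup.normalizer (D : Set G)
  have hDP : D < P := by
    refine lt_of_le_of_ne inf_le_left fun h => hPS ?_
    have : (P : Subgroup G) ≤ S := inf_eq_left.1 h
    exact (Sylow.ext (P.3 S.isPGroup' this)).symm
  have hDS : D < S := by
    refine lt_of_le_of_ne inf_le_right fun h => hPS ?_
    have : (S : Subgroup G) ≤ P := inf_eq_right.1 h
    exact (Sylow.ext (S.3 P.isPGroup' this))
  obtain ⟨y, hyP, hyN, hyD⟩ := P.isPGroup'.exists_mem_normalizer_notMem hDP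
  obtain ⟨z, hzS, hzN, hzD⟩ := S.isPGroup'.exists_mem_normalizer_notMem hDS
  have hDN : D ≤ N := Subgroup.le_normalizer
  obtain ⟨T₁, hT₁⟩ := IsPGroup.exists_le_sylow
    (P.isPGroup'.comap_of_injective N.subtype N.subtype_injective)
  obtain ⟨T₂, hT₂⟩ := IsPGroup.exists_le_sylow
    (S.isPGroup'.comap_of_injective N.subtype N.subtype_injective)
  obtain ⟨n, hn⟩ := MulAction.exists_smul_eq N T₁ T₂
  obtain ⟨k, hk, t, ht, rfl⟩ := hN.exists_mul_eq T₁ n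
  have htT : t • T₁ = T₁ := by
    rw [Sylow.smul_eq_iff_mem_normalizer]; exact Subgroup.le_normalizer ht
  rw [mul_smul, htT] at hn
  have hkD : ∀ x ∈ D, Commute (k : G) x := fun x hx =>
    (hN.commute_of_normalizer hp.out hDp hx (isPRegular_coe.2 hk) k.2).symm
  obtain ⟨R, hR⟩ := IsPGroup.exists_le_sylow (T₁.isPGroup'.map N.subtype)
  have hR1 : ∀ x ∈ P, x ∈ N → x ∈ R := fun x hx hxN =>
    hR ⟨⟨x, hxN⟩, hT₁ hx, rfl⟩
  have hR2 : ∀ x ∈ S, x ∈ N → x ∈ (k : G) • R := by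
    intro x hx hxN
    have h1 : (⟨x, hxN⟩ : N) ∈ k • T₁ := hn ▸ hT₂ hx
    have h2 : (MulAut.conj k)⁻¹ • (⟨x, hxN⟩ : N) ∈ (T₁ : Subgroup N) :=
      Subgroup.mem_pointwise_smul_iff_inv_smul_mem.1 h1
    have h3 := hR ⟨_, h2, rfl⟩
    change x ∈ (((k : G) • R : Sylow p G) : Subgroup G)
    rw [Sylow.coe_subgroup_smul, Subgroup.mem_pointwise_smul_iff_inv_smul_mem]
    exact h3
  have l1 : D < (P ⊓ R : Subgroup G) := by
    refine lt_of_le_of_ne (fun x hx => ⟨hx.1, hR1 x hx.1 (hDN hx)⟩) fun h => hyD ?_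
    rw [h]; exact ⟨hyP, hR1 y hyP hyN⟩
  have l2 : D < (((k : G) • R : Sylow p G) ⊓ S : Subgroup G) := by
    refine lt_of_le_of_ne (fun x hx => ⟨hR2 x hx.2 (hDN hx), hx.2⟩) fun h => hzD ?_
    rw [h]; exact ⟨hR2 z hzS hzN, hzS⟩
  obtain ⟨c₁, hc₁, e₁⟩ := ih _ (card_step _ _ l1) P R rfl
  obtain ⟨c₂, hc₂, e₂⟩ := ih _ (card_step _ _ l2) _ S rfl
  refine ⟨c₁ * (k : G)⁻¹ * c₂, fun x hx hx' => ?_, ?_⟩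
  · have hxD : x ∈ D := ⟨hx, hx'⟩
    have := (l1.le hxD).2
    exact ((hc₁ x hx this).mul_left (hkD x hxD).inv_left).mul_left (hc₂ x (l2.le hxD).1 hx')
  · rw [mul_smul, e₂, mul_smul, inv_smul_smul, e₁]

/-- **Frobenius' normal `p`-complement theorem**. -/
theorem isPNilpotent_of_normalizer.{u} {p : ℕ} [hp : Fact p.Prime] (G : Type u) [Group G]
    [Finite G] (H : ∀ X : Subgroup G, IsPGroup p X → X ≠ ⊥ →
      IsPNilpotent p (Subgroup.normalizer (X : Set G))) : IsPNilpotent p G := by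
  induction hn : Nat.card G using Nat.strong_induction_on generalizing G with
  | _ n ih =>
  subst hn
  obtain ⟨P⟩ : Nonempty (Sylow p G) := inferInstance
  by_cases hP : (P : Subgroup G) = ⊥
  · intro x y _ _
    have h1 := P.not_dvd_index
    rw [hP, Subgroup.index_bot] at h1
    exact Nat.Coprime.coprime_dvd_left (orderOf_dvd_natCard _)
      ((Nat.Prime.coprime_iff_not_dvd hp.out).2 h1).symm
  have hfocal : (P : Subgroup G).focalSubgroupOf ≤ commutator P := by
    have : (P : Subgroup G).focalSubgroup ≤ (commutator P).map (P : Subgroup G).subtype := by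
      unfold Subgroup.focalSubgroup
      rw [Subgroup.closure_le]
      rintro _ ⟨hg, x, hx, u, rfl⟩
      have hy : u * x * u⁻¹ ∈ (P : Subgroup G) := by
        have := P.mul_mem (P.inv_mem hg) hx
        simpa [commutatorElement_def, mul_assoc] using this
      obtain ⟨c, hc, e⟩ := P.exists_centralizer_smul_eq H (u⁻¹ • P)
      have hxS : x ∈ u⁻¹ • P := by
        change x ∈ ((u⁻¹ • P : Sylow p G) : Subgroup G)
        rw [Sylow.coe_subgroup_smul, Subgroup.mem_pointwise_smul_iff_inv_smul_mem]
        simpa [MulAut.smul_def] using hy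
      have hcx := hc x hx hxS
      rw [smul_smul, Sylow.smul_eq_iff_mem_normalizer] at e
      have hN := H P P.isPGroup' hP
      have hT : ∃ k, IsPRegular p k ∧ k ∈ Subgroup.normalizer ((P : Subgroup G) : Set G) ∧
          ∃ t ∈ P, k * t = c * u⁻¹ := by
        obtain ⟨k, hk, t, ht, e'⟩ := hN.exists_mul_eq (P.subtype Subgroup.le_normalizer)
          ⟨c * u⁻¹, e⟩
        exact ⟨k, isPRegular_coe.2 hk, k.2, t, ht, by simpa using congrArg Subtype.val e'⟩
      obtain ⟨k, hk, hkN, t, ht, hkt⟩ := hT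
      have hu : u = t⁻¹ * k⁻¹ * c := by
        rw [← mul_inv_rev, hkt]; group
      have hkx := hN.commute_of_normalizer hp.out P.isPGroup' hx hk hkN
      have key : ⁅x, u⁆ = ⁅x, t⁻¹⁆ := by
        have : u * x⁻¹ * u⁻¹ = t⁻¹ * x⁻¹ * t := by
          have h1 : c * x⁻¹ * c⁻¹ = x⁻¹ := by rw [hcx.inv_right.eq]; group
          have h2 : k⁻¹ * x⁻¹ * k = x⁻¹ := by rw [hkx.inv_inv.symm.eq]; group
          calc u * x⁻¹ * u⁻¹ = t⁻¹ * (k⁻¹ * (c * x⁻¹ * c⁻¹) * k) * t := by rw [hu]; group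
            _ = _ := by rw [h1, h2]
        rw [commutatorElement_def, commutatorElement_def, inv_inv, mul_assoc, mul_assoc,
          ← mul_assoc u, this]
        group
      rw [key]
      refine ⟨⁅⟨x, hx⟩, ⟨t, ht⟩⁻¹⁆, Subgroup.commutator_mem_commutator trivial trivial, ?_⟩
      simp [commutatorElement_def]
    intro x hx
    obtain ⟨y, hy, e⟩ := this hx
    rwa [Subtype.ext e] at hy
  have hne : Nontrivial P := (Subgroup.nontrivial_iff_ne_bot _).2 hP
  have hnil := P.isPGroup'.isNilpotent
  have hlt : commutator P < ⊤ := Group.IsSolvable.commutator_lt_top_of_nontrivial P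
  have hsurj := Subgroup.transferFocal_surjective P
  set φ := (P : Subgroup G).transferFocal
  have hlt' : φ.ker < ⊤ := by
    rw [lt_top_iff_ne_top, Ne, MonoidHom.ker_eq_top_iff]
    intro h1
    refine hlt.not_ge (le_trans (fun x _ => ?_) hfocal)
    rw [← QuotientGroup.eq_one_iff]
    obtain ⟨g, hg⟩ := hsurj x
    rw [← hg, h1, MonoidHom.one_apply]
  have hker : IsPNilpotent p φ.ker := by
    refine ih _ ?_ φ.ker (fun X hX hX1 => ?_) rfl
    · have h1 : Nat.card φ.ker < Nat.card (⊤ : Subgroup G) := Set.ncard_lt_ncard hlt'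
      simpa using h1
    · have h1 := H (X.map φ.ker.subtype) (hX.map _)
        (by rwa [Ne, Subgroup.map_eq_bot_iff_of_injective _ φ.ker.subtype_injective])
      rw [isPNilpotent_subgroup_iff] at h1 ⊢
      have h2 : ∀ x ∈ Subgroup.normalizer (X : Set φ.ker),
          (x : G) ∈ Subgroup.normalizer ((X.map φ.ker.subtype : Subgroup G) : Set G) :=
        fun x hx => Subgroup.le_normalizer_map φ.ker.subtype ⟨x, hx, rfl⟩
      intro x hx y hy hx' hy'
      exact isPRegular_coe.1 (h1 x (h2 x hx) y (h2 y hy) (isPRegular_coe.2 hx')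
        (isPRegular_coe.2 hy'))
  refine isPNilpotent_of_isPGroup_quotient hp.out _ hker ?_
  exact (P.isPGroup'.to_quotient _).of_equiv
    (QuotientGroup.quotientKerEquivOfSurjective φ hsurj).symm

end Frobenius

section Linear

variable {G : Type*} [Group G] {p : ℕ}

theorem IsPGroup.exists_card_mul_eq [Finite G] [hp : Fact p.Prime] {A B : Subgroup G}
    (hA : IsPGroup p A) (h : B < A) : ∃ C, B ≤ C ∧ C < A ∧ Nat.card C * p = Nat.card A := by
  obtain ⟨m, hm⟩ := IsPGroup.iff_card.1 hA
  obtain ⟨n, hn⟩ := IsPGroup.iff_card.1 (hA.to_le h.le)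
  have hlt : Nat.card B < Nat.card A := Set.ncard_lt_ncard h
  have hnm : n < m := by
    rw [hm, hn] at hlt
    exact (Nat.pow_lt_pow_iff_right hp.out.one_lt).1 hlt
  have hm1 : p ^ (m - 1) * p = p ^ m := by
    rw [← pow_succ]; congr 1; omega
  obtain ⟨K, hK, hBK⟩ := Sylow.exists_subgroup_card_pow_prime_le (G := A) p (n := n) (m := m - 1)
    (by rw [hm, ← hm1]; exact dvd_mul_right _ _) (B.subgroupOf A)
    (by rw [← hn]; exact Nat.card_congr (Subgroup.subgroupOfEquivOfLe h.le).toEquiv) (by omega)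
  have hcard : Nat.card (K.map A.subtype) = p ^ (m - 1) := by
    rw [Subgroup.card_map_of_injective A.subtype_injective, hK]
  have hle : K.map A.subtype ≤ A := Subgroup.map_subtype_le K
  refine ⟨K.map A.subtype, ?_, lt_of_le_of_ne hle ?_, by rw [hcard, hm1, hm]⟩
  · intro b hb
    exact ⟨⟨b, h.le hb⟩, hBK hb, rfl⟩
  · intro e
    rw [e, hm] at hcard
    have := (Nat.pow_right_injective hp.out.two_le) hcard
    omega

variable {V : Type*} [AddCommGroup V] [Finite V] [DistribMulAction G V]

theorem IsPGroup.exists_fixed_ne_zero [hp : Fact p.Prime] (hpV : ∀ v : V, p • v = 0)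
    {P : Subgroup G} (hP : IsPGroup p P) {W : AddSubgroup V}
    (hW : ∀ g ∈ P, ∀ w ∈ W, g • w ∈ W) (hne : W ≠ ⊥) :
    ∃ w ∈ W, w ≠ 0 ∧ ∀ g ∈ P, g • w = w := by
  let _ : MulAction P W :=
    { smul g w := ⟨(g : G) • (w : V), hW g g.2 w w.2⟩
      one_smul w := Subtype.ext (one_smul G (w : V))
      mul_smul g h w := Subtype.ext (mul_smul (g : G) (h : G) (w : V)) }
  have hdvd : p ∣ Nat.card W := by
    have := (AddSubgroup.nontrivial_iff_ne_bot W).2 hne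
    obtain ⟨w, hw0⟩ := exists_ne (0 : W)
    have h1 : addOrderOf w = p := by
      refine addOrderOf_eq_prime ?_ hw0
      exact Subtype.ext (hpV w)
    rw [← h1]
    exact addOrderOf_dvd_natCard w
  obtain ⟨b, hb, hb0⟩ := hP.exists_fixed_point_of_prime_dvd_card_of_fixed_point W hdvd (a := 0)
    (fun g => Subtype.ext (smul_zero (g : G)))
  exact ⟨b, b.2, fun h => hb0 (Subtype.ext h.symm), fun g hg =>
    congrArg Subtype.val (hb ⟨g, hg⟩)⟩

/-- If an element `a` of `p`-power order, `p` odd, stabilizes an additive subgroup `M` of exponent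
`p` and has at least `|M| / p` fixed points there, then `1 + a + ⋯ + a ^ (p - 1)` vanishes
on `M`. -/
theorem sum_range_pow_smul_eq_zero [hp : Fact p.Prime] (hp2 : p ≠ 2) (hpV : ∀ v : V, p • v = 0)
    {a : G} (ha : IsPGroup p (Subgroup.zpowers a)) {M M₀ : AddSubgroup V}
    (haM : ∀ v ∈ M, a • v ∈ M) (hle : M₀ ≤ M) (hM₀ : ∀ v ∈ M₀, a • v = v)
    (hcard : Nat.card M ≤ p * Nat.card M₀) {w : V} (hw : w ∈ M) :
    ∑ i ∈ Finset.range p, a ^ i • w = 0 := by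
  let d : V →+ V := DistribSMul.toAddMonoidHom V a - AddMonoidHom.id V
  have hd : ∀ v, d v = a • v - v := fun v => rfl
  let f : M →+ V := d.comp M.subtype
  have hker : Nat.card M₀ ≤ Nat.card f.ker := by
    refine Nat.card_le_card_of_injective
      (fun v : M₀ => (⟨⟨v, hle v.2⟩, ?_⟩ : f.ker)) fun v w h => ?_
    · rw [AddMonoidHom.mem_ker]
      exact sub_eq_zero.2 (hM₀ v v.2)
    · exact Subtype.ext (congrArg (fun x : f.ker => ((x : M) : V)) h)
  have hrange : Nat.card f.range ≤ p := by
    have h1 := f.ker.card_mul_index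
    rw [AddSubgroup.index_ker] at h1
    have h2 : 0 < Nat.card f.ker := Nat.card_pos
    refine Nat.le_of_mul_le_mul_left ?_ h2
    rw [h1]
    exact hcard.trans (by rw [mul_comm]; exact Nat.mul_le_mul_right _ hker)
  have hfix : ∀ r ∈ f.range, a • r = r := by
    by_cases hbot : f.range = ⊥
    · intro r hr
      rw [hbot, AddSubgroup.mem_bot] at hr
      rw [hr, smul_zero]
    have hinv : ∀ g ∈ Subgroup.zpowers a, ∀ r ∈ f.range, g • r ∈ f.range := by
      have h1 : ∀ n : ℕ, ∀ r ∈ f.range, a ^ n • r ∈ f.range := by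
        intro n
        induction n with
        | zero => intro r hr; simpa using hr
        | succ n ih =>
          intro r hr
          rw [pow_succ, mul_smul]
          refine ih _ ?_
          obtain ⟨v, rfl⟩ := hr
          refine ⟨⟨a • v, haM v v.2⟩, ?_⟩
          change a • (a • (v : V)) - a • (v : V) = a • (a • (v : V) - v)
          rw [smul_sub]
      intro g hg
      have hfin : IsOfFinOrder a := by
        obtain ⟨k, hk⟩ := ha ⟨a, Subgroup.mem_zpowers a⟩
        rw [isOfFinOrder_iff_pow_eq_one]
        exact ⟨p ^ k, pow_pos hp.out.pos k, congrArg Subtype.val hk⟩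
      obtain ⟨n, rfl⟩ := (hfin.mem_powers_iff_mem_zpowers).2 hg
      exact h1 n
    obtain ⟨r, hr, hr0, hra⟩ := ha.exists_fixed_ne_zero hpV hinv hbot
    have hr1 : addOrderOf (⟨r, hr⟩ : f.range) = p :=
      addOrderOf_eq_prime (Subtype.ext (hpV r)) fun h => hr0 (congrArg Subtype.val h)
    have hcardr : Nat.card f.range = p := by
      refine le_antisymm hrange (Nat.le_of_dvd Nat.card_pos ?_)
      conv_lhs => rw [← hr1]
      exact addOrderOf_dvd_natCard _
    intro s hs
    obtain ⟨n, hn⟩ := mem_zmultiples_of_prime_card hcardr (g := ⟨r, hr⟩) (g' := ⟨s, hs⟩)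
      (fun h => hr0 (congrArg Subtype.val h))
    have hn' : n • r = s := congrArg Subtype.val hn
    rw [← hn', smul_comm, hra a (Subgroup.mem_zpowers a)]
  have hdw : a • d w = d w := hfix _ ⟨⟨w, hw⟩, rfl⟩
  have hpow : ∀ i : ℕ, a ^ i • w = w + i • d w := by
    intro i
    induction i with
    | zero => simp
    | succ i ih =>
      rw [pow_succ', mul_smul, ih, smul_add, smul_comm, hdw, succ_nsmul, hd]
      abel
  simp_rw [hpow]
  rw [Finset.sum_add_distrib, Finset.sum_const, Finset.card_range, hpV, zero_add,
    ← Finset.sum_smul]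
  have h2 : p ∣ ∑ i ∈ Finset.range p, i := by
    have h3 : p ∣ (∑ i ∈ Finset.range p, i) * 2 := by
      rw [Finset.sum_range_id_mul_two]; exact dvd_mul_right _ _
    refine (Nat.Coprime.dvd_of_dvd_mul_right ?_ h3)
    exact (Nat.coprime_primes hp.out Nat.prime_two).2 hp2
  obtain ⟨m, hm⟩ := h2
  rw [hm, mul_comm, mul_nsmul', hpV, nsmul_zero]

theorem coprime_card_of_isPRegular [Finite G] [hp : Fact p.Prime] {Q : Subgroup G}
    (hQ : ∀ x ∈ Q, IsPRegular p x) : (Nat.card Q).Coprime p := by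
  rw [Nat.coprime_comm, Nat.Prime.coprime_iff_not_dvd hp.out]
  intro h
  obtain ⟨x, hx⟩ := exists_prime_orderOf_dvd_card' p h
  have h1 := isPRegular_coe.1 (hQ x x.2)
  rw [IsPRegular, hx, Nat.coprime_self] at h1
  exact hp.out.one_lt.ne' h1

theorem exists_fixedPointFree_subgroup [Finite G] [hp : Fact p.Prime] {A Q : Subgroup G}
    (hA : IsPGroup p A) (hAc : ∀ a ∈ A, ∀ b ∈ A, Commute a b)
    (hQc : ∀ x ∈ Q, ∀ y ∈ Q, Commute x y) (hQ : ∀ x ∈ Q, IsPRegular p x)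
    (hAQ : ∀ a ∈ A, ∀ x ∈ Q, a * x * a⁻¹ ∈ Q) (hne : ∃ a ∈ A, ∃ x ∈ Q, ¬ Commute a x) :
    ∃ B Q₁ : Subgroup G, B < A ∧ Q₁ ≤ Q ∧ Q₁ ≠ ⊥ ∧ (∀ a ∈ A, ∀ x ∈ Q₁, a * x * a⁻¹ ∈ Q₁) ∧
      (∀ b ∈ B, ∀ x ∈ Q₁, Commute b x) ∧ ∀ a ∈ A, a ∉ B → ∀ x ∈ Q₁, Commute a x → x = 1 := by
  obtain ⟨B, ⟨hBA, x, hx, hBx, a, ha, hax⟩, hmax⟩ := Set.Finite.exists_maximal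
    (Set.toFinite {B : Subgroup G | B ≤ A ∧ ∃ x ∈ Q, (∀ b ∈ B, Commute b x) ∧
      ∃ a ∈ A, ¬ Commute a x})
    ⟨⊥, by
      obtain ⟨a, ha, x, hx, h⟩ := hne
      refine ⟨bot_le, x, hx, fun b hb => ?_, a, ha, h⟩
      rw [Subgroup.mem_bot.1 hb]
      exact Commute.one_left x⟩
  let _ : CommGroup Q :=
    { (inferInstance : Group Q) with
      mul_comm := fun x y => Subtype.ext (hQc x x.2 y y.2) }
  let _ := Fintype.ofFinite A
  let c : A → Q →* Q := fun a =>
    { toFun x := ⟨a * x * (a : G)⁻¹, hAQ a a.2 x x.2⟩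
      map_one' := Subtype.ext (by simp)
      map_mul' x y := Subtype.ext (by simp) }
  have hc : ∀ a x, (c a x : G) = a * x * (a : G)⁻¹ := fun _ _ => rfl
  have hcm : ∀ a b x, c a (c b x) = c (a * b) x := fun a b x =>
    Subtype.ext (by simp [hc, mul_assoc])
  let φ : Q →* Q := ∏ a : A, c a
  have hφ : ∀ x, φ x = ∏ a : A, c a x := fun x => MonoidHom.finsetProd_apply _ _ _
  have hφc : ∀ a x, φ (c a x) = φ x := by
    intro a x
    rw [hφ, hφ]
    exact Fintype.prod_equiv (Equiv.mulRight a) _ _ fun b => hcm b a x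
  have hφfix : ∀ x, (∀ a, c a x = x) → φ x = 1 → x = 1 := by
    intro x h1 h2
    rw [hφ, Finset.prod_congr rfl fun a _ => h1 a, Finset.prod_const, Finset.card_univ,
      ← Nat.card_eq_fintype_card] at h2
    obtain ⟨n, hn⟩ := IsPGroup.iff_card.1 hA
    have h3 : orderOf x = 1 := by
      refine Nat.eq_one_of_dvd_coprimes (Nat.Coprime.pow_left n ?_)
        (hn ▸ orderOf_dvd_of_pow_eq_one h2) (dvd_refl (orderOf x))
      exact (isPRegular_coe.1 (hQ x x.2)).symm
    exact orderOf_eq_one_iff.1 h3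
  have hcomm : ∀ a x, c a x = x ↔ Commute (a : G) x := fun a x => by
    rw [Subtype.ext_iff, hc, mul_inv_eq_iff_eq_mul]; rfl
  let R : Subgroup Q := φ.ker ⊓ (Subgroup.centralizer (B : Set G)).subgroupOf Q
  have hR : ∀ x, x ∈ R ↔ φ x = 1 ∧ ∀ b ∈ B, Commute b (x : G) := fun x => by
    rw [Subgroup.mem_inf, MonoidHom.mem_ker, Subgroup.mem_subgroupOf, Subgroup.mem_centralizer_iff]
    rfl
  have hcB : ∀ (a : A) (x : Q), (∀ b ∈ B, Commute b (x : G)) → ∀ b ∈ B, Commute b (c a x : G) := by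
    intro a x h b hb
    have h1 := hAc _ (hBA hb) a a.2
    rw [hc]
    exact (h1.mul_right (h b hb)).mul_right h1.inv_right
  refine ⟨B, R.map Q.subtype, lt_of_le_of_ne hBA fun h => hax (hBx a (h ▸ ha)),
    Subgroup.map_subtype_le R, ?_, ?_, ?_, ?_⟩
  · rw [Ne, Subgroup.map_eq_bot_iff_of_injective _ Q.subtype_injective]
    intro hbot
    have h1 : (⟨x, hx⟩ : Q)⁻¹ * c ⟨a, ha⟩ ⟨x, hx⟩ ∈ R := by
      rw [hR, map_mul, map_inv, hφc, inv_mul_cancel]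
      exact ⟨rfl, fun b hb => (hBx b hb).inv_right.mul_right (hcB _ ⟨x, hx⟩ hBx b hb)⟩
    rw [hbot, Subgroup.mem_bot, inv_mul_eq_one, eq_comm, hcomm] at h1
    exact hax h1
  · rintro a ha _ ⟨y, hy, rfl⟩
    rw [SetLike.mem_coe, hR] at hy
    exact ⟨c ⟨a, ha⟩ y, (hR _).2 ⟨(hφc _ _).trans hy.1, hcB _ _ hy.2⟩, rfl⟩
  · rintro b hb _ ⟨y, hy, rfl⟩
    exact ((hR _).1 hy).2 b hb
  · rintro a ha haB _ ⟨y, hy, rfl⟩ hay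
    rw [SetLike.mem_coe, hR] at hy
    rw [Subgroup.subtype_apply, OneMemClass.coe_eq_one]
    refine hφfix y (fun a' => ?_) hy.1
    rw [hcomm]
    by_contra hcon
    have hle : B ⊔ Subgroup.zpowers a ≤ A :=
      sup_le hBA ((Subgroup.zpowers_le).2 ha)
    have hcent : B ⊔ Subgroup.zpowers a ≤ Subgroup.centralizer {(y : G)} := by
      refine sup_le (fun b hb => ?_) ((Subgroup.zpowers_le).2 ?_)
      · rw [Subgroup.mem_centralizer_singleton_iff]; exact hy.2 b hb
      · rw [Subgroup.mem_centralizer_singleton_iff]; exact hay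
    have := hmax ⟨hle, y, y.2, fun b hb =>
      Subgroup.mem_centralizer_singleton_iff.1 (hcent hb), a', a'.2, hcon⟩ le_sup_left
    exact haB (this (Subgroup.mem_sup_right (Subgroup.mem_zpowers a)))

open scoped Classical in
theorem exists_lt_card_fixedPoints [Finite G] [hp : Fact p.Prime] (hp2 : p ≠ 2)
    (hpV : ∀ v : V, p • v = 0) {A Q : Subgroup G}
    (hA : IsPGroup p A) (hAc : ∀ a ∈ A, ∀ b ∈ A, Commute a b)
    (hQc : ∀ x ∈ Q, ∀ y ∈ Q, Commute x y) (hQ : ∀ x ∈ Q, IsPRegular p x)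
    (hAQ : ∀ a ∈ A, ∀ x ∈ Q, a * x * a⁻¹ ∈ Q) (hne : ∃ a ∈ A, ∃ x ∈ Q, ¬ Commute a x)
    (hfaith : ∀ x ∈ Q, (∀ v : V, x • v = v) → x = 1) :
    ∃ C ≤ A, Nat.card C * p = Nat.card A ∧
      p * Nat.card (FixedPoints.addSubgroup A V) < Nat.card (FixedPoints.addSubgroup C V) := by
  obtain ⟨B, Q₁, hBA, hQ₁, hQ₁ne, hAQ₁, hBQ₁, hfpf⟩ :=
    exists_fixedPointFree_subgroup hA hAc hQc hQ hAQ hne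
  obtain ⟨C, hBC, hCA, hcard⟩ := hA.exists_card_mul_eq hBA
  refine ⟨C, hCA.le, hcard, ?_⟩
  obtain ⟨a, haA, haC⟩ := SetLike.exists_of_lt hCA
  have haP : IsPGroup p (Subgroup.zpowers a) := hA.to_le (by simpa using haA)
  by_contra hcon
  have hzero : ∀ w : V, (∀ c ∈ C, c • w = w) → ∑ i ∈ Finset.range p, a ^ i • w = 0 := by
    intro w hw
    refine sum_range_pow_smul_eq_zero hp2 hpV haP (M := FixedPoints.addSubgroup C V)
      (M₀ := FixedPoints.addSubgroup A V) ?_ ?_ ?_ (not_lt.1 hcon) ?_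
    · intro v hv c
      have h1 : c • v = v := hv c
      change (c : G) • a • v = a • v
      rw [← mul_smul, (hAc _ (hCA.le c.2) _ haA).eq, mul_smul]
      exact congrArg (a • ·) h1
    · intro v hv c
      exact hv ⟨c, hCA.le c.2⟩
    · intro v hv
      exact hv ⟨a, haA⟩
    · intro c
      exact hw c c.2
  have hpow : ∀ i < p, a ^ i ∈ C → i = 0 := by
    intro i hi hiC
    by_contra hi0
    obtain ⟨k, hk⟩ := IsPGroup.iff_orderOf.1 haP ⟨a, Subgroup.mem_zpowers a⟩
    rw [Subgroup.orderOf_mk] at hk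
    have hcop : i.Coprime (orderOf a) := by
      rw [hk]
      refine Nat.Coprime.pow_right k (Nat.coprime_comm.1 ?_)
      exact (Nat.Prime.coprime_iff_not_dvd hp.out).2 fun h =>
        (Nat.le_of_dvd (Nat.pos_of_ne_zero hi0) h).not_gt hi
    obtain ⟨m, hm⟩ := exists_pow_eq_self_of_coprime hcop
    exact haC (hm ▸ C.pow_mem hiC m)
  let _ := Fintype.ofFinite Q₁
  let V₁ : AddSubgroup V := (∑ x : Q₁, DistribSMul.toAddMonoidHom V (x : G)).ker
  have hV₁ : ∀ v, v ∈ V₁ ↔ ∑ x : Q₁, (x : G) • v = 0 := fun v => by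
    rw [AddMonoidHom.mem_ker, AddMonoidHom.finsetSum_apply]; rfl
  have hAV₁ : ∀ g ∈ A, ∀ v ∈ V₁, g • v ∈ V₁ := by
    intro g hg v hv
    rw [hV₁] at hv ⊢
    have : ∑ x : Q₁, (x : G) • g • v = g • ∑ x : Q₁, (x : G) • v := by
      rw [Finset.smul_sum]
      refine Fintype.sum_equiv (Equiv.ofBijective
        (fun x : Q₁ => (⟨g⁻¹ * x * g, by
          simpa using hAQ₁ _ (A.inv_mem hg) x x.2⟩ : Q₁)) (Finite.injective_iff_bijective.1 ?_))
        _ _ fun x => ?_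
      · intro x y h
        exact Subtype.ext (by simpa using congrArg Subtype.val h)
      · rw [Equiv.ofBijective_apply, ← mul_smul, ← mul_smul]
        congr 1
        group
    rw [this, hv, smul_zero]
  have hV₁ne : V₁ ≠ ⊥ := by
    obtain ⟨y, hy⟩ := (Subgroup.ne_bot_iff_exists_ne_one).1 hQ₁ne
    have hy' : (y : G) ≠ 1 := by simpa using hy
    have : ∃ v : V, (y : G) • v ≠ v := by
      by_contra! h
      exact hy' (hfaith y (hQ₁ y.2) h)
    obtain ⟨v, hv⟩ := this
    intro hbot
    have h1 : (y : G) • v - v ∈ V₁ := by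
      rw [hV₁]
      simp_rw [smul_sub, Finset.sum_sub_distrib]
      rw [sub_eq_zero]
      exact Fintype.sum_equiv (Equiv.mulRight y) _ _ fun x => by
        simp [mul_smul]
    rw [hbot, AddSubgroup.mem_bot, sub_eq_zero] at h1
    exact hv h1
  obtain ⟨u, hu, hu0, huB⟩ := (hA.to_le hBA.le).exists_fixed_ne_zero hpV
    (fun g hg => hAV₁ g (hBA.le hg)) hV₁ne
  let _ := Fintype.ofFinite (C ⧸ B.subgroupOf C)
  let T : V → V := fun v => ∑ q : C ⧸ B.subgroupOf C, ((q.out : C) : G) • v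
  have hT : ∀ v, (∀ b ∈ B, b • v = v) → ∀ c ∈ C, c • T v = T v := by
    intro v hv c hc
    change c • ∑ q : C ⧸ B.subgroupOf C, ((q.out : C) : G) • v =
      ∑ q : C ⧸ B.subgroupOf C, ((q.out : C) : G) • v
    rw [Finset.smul_sum]
    refine Fintype.sum_equiv (MulAction.toPerm (⟨c, hc⟩ : C)) _ _ fun q => ?_
    have h1 : (((⟨c, hc⟩ : C) • q).out)⁻¹ * (⟨c, hc⟩ * q.out) ∈ B.subgroupOf C := by
      rw [← QuotientGroup.eq, QuotientGroup.out_eq']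
      change (⟨c, hc⟩ : C) • q = (⟨c, hc⟩ : C) • (q.out : C ⧸ B.subgroupOf C)
      rw [QuotientGroup.out_eq']
    have h2 := hv _ (Subgroup.mem_subgroupOf.1 h1)
    rw [MulAction.toPerm_apply]
    conv_rhs => rw [← h2]
    rw [← mul_smul, ← mul_smul]
    congr 1
    simp
  have hQ₁B : ∀ x ∈ Q₁, ∀ b ∈ B, b • x • u = x • u := by
    intro x hx b hb
    rw [← mul_smul, (hBQ₁ b hb x hx).eq, mul_smul, huB b hb]
  have hinner : ∀ g ∈ A, g ∉ B → ∑ x : Q₁, (x : G)⁻¹ • g • (x : G) • u = 0 := by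
    intro g hg hgB
    have h1 : ∑ x : Q₁, (x : G)⁻¹ • g • (x : G) • u = ∑ x : Q₁, (x : G) • g • u := by
      refine Fintype.sum_equiv (Equiv.ofBijective
        (fun x : Q₁ => (⟨x⁻¹ * (g * x * g⁻¹), Q₁.mul_mem (Q₁.inv_mem x.2)
          (hAQ₁ g hg x x.2)⟩ : Q₁)) (Finite.injective_iff_bijective.1 ?_)) _ _ fun x => ?_
      · intro x y h
        have h2 : (x : G)⁻¹ * (g * x * g⁻¹) = (y : G)⁻¹ * (g * y * g⁻¹) := congrArg Subtype.val h
        have h3 : Commute g ((y : G) * (x : G)⁻¹) := by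
          have h4 : g = (y : G) * (x : G)⁻¹ * g * (x * (y : G)⁻¹) := by
            have h5 : (x : G)⁻¹ * g * x = (y : G)⁻¹ * g * y := by
              have := congrArg (· * g) h2
              simpa [mul_assoc] using this
            calc g = y * ((y : G)⁻¹ * g * y) * (y : G)⁻¹ := by group
              _ = y * ((x : G)⁻¹ * g * x) * (y : G)⁻¹ := by rw [h5]
              _ = _ := by group
          change g * ((y : G) * (x : G)⁻¹) = (y : G) * (x : G)⁻¹ * g
          conv_lhs => rw [h4]
          group
        have h4 := hfpf g hg hgB _ (Q₁.mul_mem y.2 (Q₁.inv_mem x.2)) h3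
        exact Subtype.ext (mul_inv_eq_one.1 h4).symm
      · rw [Equiv.ofBijective_apply, ← mul_smul, ← mul_smul, ← mul_smul]
        congr 1
        simp [mul_assoc]
    rw [h1]
    exact (hV₁ _).1 (hAV₁ g hg u hu)
  have hident : ∀ i < p, ∀ q : C ⧸ B.subgroupOf C,
      ∑ x : Q₁, (x : G)⁻¹ • (a ^ i * ((q.out : C) : G)) • (x : G) • u =
        if i = 0 ∧ q = ((1 : C) : C ⧸ B.subgroupOf C) then Nat.card Q₁ • u else 0 := by
    intro i hi q
    split_ifs with h
    · have h1 : ((q.out : C) : G) ∈ B := by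
        have := QuotientGroup.out_eq' q
        rw [h.2, QuotientGroup.eq, mul_one] at this
        rw [h.2]
        simpa [Subgroup.mem_subgroupOf] using this
      have h2 : ∀ x : Q₁, (x : G)⁻¹ • (a ^ i * ((q.out : C) : G)) • (x : G) • u = u := by
        intro x
        rw [h.1, pow_zero, one_mul, hQ₁B x x.2 _ h1, inv_smul_smul]
      rw [Finset.sum_congr rfl fun x _ => h2 x, Finset.sum_const, Finset.card_univ,
        Nat.card_eq_fintype_card]
    · refine hinner _ (A.mul_mem (A.pow_mem haA i) (hCA.le q.out.2)) fun hB => h ?_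
      have h1 : i = 0 := hpow i hi ((Subgroup.mul_mem_cancel_right _ q.out.2).1 (hBC hB))
      refine ⟨h1, ?_⟩
      rw [h1, pow_zero, one_mul] at hB
      rw [← QuotientGroup.out_eq' q, QuotientGroup.eq, mul_one]
      exact (Subgroup.inv_mem_iff _).2 hB
  have htotal : ∑ x : Q₁, (x : G)⁻¹ • ∑ i ∈ Finset.range p, a ^ i • T ((x : G) • u) =
      Nat.card Q₁ • u := by
    have h1 : ∀ x : Q₁, (x : G)⁻¹ • ∑ i ∈ Finset.range p, a ^ i • T ((x : G) • u) =
        ∑ i ∈ Finset.range p, ∑ q : C ⧸ B.subgroupOf C,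
          (x : G)⁻¹ • (a ^ i * ((q.out : C) : G)) • (x : G) • u := by
      intro x
      simp only [T, Finset.smul_sum, mul_smul]
    rw [Finset.sum_congr rfl fun x _ => h1 x, Finset.sum_comm]
    rw [Finset.sum_congr rfl fun i hi => (Finset.sum_comm.trans
      (Finset.sum_congr rfl fun q _ => hident i (Finset.mem_range.1 hi) q))]
    rw [Finset.sum_eq_single_of_mem 0 (Finset.mem_range.2 hp.out.pos) fun i _ hi => by simp [hi]]
    rw [Finset.sum_eq_single_of_mem ((1 : C) : C ⧸ B.subgroupOf C) (Finset.mem_univ _)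
      fun q _ hq => by rw [if_neg fun h => hq h.2]]
    simp
  rw [Finset.sum_eq_zero fun x _ => by rw [hzero _ (hT _ (hQ₁B x x.2)), smul_zero]] at htotal
  have h1 : addOrderOf u = p := addOrderOf_eq_prime (hpV u) hu0
  have h2 : p ∣ Nat.card Q₁ := h1 ▸ addOrderOf_dvd_of_nsmul_eq_zero htotal.symm
  exact (Nat.Prime.coprime_iff_not_dvd hp.out).1
    (coprime_card_of_isPRegular fun x hx => hQ x (hQ₁ hx)).symm h2

end Linear

section CharLocal

variable {G G' : Type*} [Group G] [Group G'] {p : ℕ}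

open scoped Pointwise

/-- All normalizers in `G` of nontrivial characteristic subgroups of `P` are `p`-nilpotent. -/
def CharLocallyPNilpotent (p : ℕ) (P : Subgroup G) : Prop :=
  ∀ C : Subgroup P, C.Characteristic → C ≠ ⊥ →
    IsPNilpotent p (Subgroup.normalizer (C.map P.subtype : Set G))

theorem Subgroup.Characteristic.map_equiv {C : Subgroup G} (hC : C.Characteristic) (e : G ≃* G') :
    (C.map e.toMonoidHom).Characteristic := by
  rw [Subgroup.characteristic_iff_map_eq] at hC ⊢
  intro φ
  conv_rhs => rw [← hC ((e.trans φ).trans e.symm)]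
  rw [Subgroup.map_map, Subgroup.map_map]
  congr 1
  ext x
  simp

theorem Subgroup.normalizer_le_normalizer_map_of_characteristic (T : Subgroup G) (C : Subgroup T)
    [hC : C.Characteristic] :
    Subgroup.normalizer (T : Set G) ≤ Subgroup.normalizer (C.map T.subtype : Set G) := by
  have key : ∀ x ∈ Subgroup.normalizer (T : Set G), ∀ c ∈ C.map T.subtype,
      x * c * x⁻¹ ∈ C.map T.subtype := by
    rintro x hx _ ⟨c, hc, rfl⟩
    have h1 := Subgroup.characteristic_iff_map_eq.1 hC (T.normalizerMonoidHom ⟨x, hx⟩)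
    refine ⟨T.normalizerMonoidHom ⟨x, hx⟩ c, ?_, rfl⟩
    rw [← h1]
    exact ⟨c, hc, rfl⟩
  intro x hx
  rw [Subgroup.mem_normalizer_iff]
  intro g
  refine ⟨key x hx g, fun h => ?_⟩
  have := key x⁻¹ (Subgroup.inv_mem _ hx) _ h
  simpa [mul_assoc] using this

theorem Subgroup.le_normalizer_map_of_characteristic (T : Subgroup G) (C : Subgroup T)
    [hC : C.Characteristic] : T ≤ Subgroup.normalizer (C.map T.subtype : Set G) :=
  Subgroup.le_normalizer.trans (T.normalizer_le_normalizer_map_of_characteristic C)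

theorem CharLocallyPNilpotent.of_map {T : Subgroup G} {f : G →* G'} (hf : Function.Injective f)
    (h : CharLocallyPNilpotent p (T.map f)) : CharLocallyPNilpotent p T := by
  intro C hC hne
  have h1 := h _ (hC.map_equiv (T.equivMapOfInjective f hf))
    (by rwa [Ne, Subgroup.map_eq_bot_iff_of_injective _ (T.equivMapOfInjective f hf).injective])
  have h2 : ((C.map (T.equivMapOfInjective f hf).toMonoidHom).map (T.map f).subtype) =
      (C.map T.subtype).map f := by
    rw [Subgroup.map_map, Subgroup.map_map]
    congr 1
  rw [h2] at h1
  refine h1.of_injective (f := (f.comp (Subgroup.subtype _)).codRestrict _ fun x =>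
    Subgroup.le_normalizer_map f ⟨x, x.2, rfl⟩) fun x y hxy => ?_
  exact Subtype.ext (hf (congrArg Subtype.val hxy))

theorem CharLocallyPNilpotent.sylow [Finite G] [Fact p.Prime] {P : Sylow p G}
    (h : CharLocallyPNilpotent p (P : Subgroup G)) (Q : Sylow p G) :
    CharLocallyPNilpotent p (Q : Subgroup G) := by
  obtain ⟨g, rfl⟩ := MulAction.exists_smul_eq G Q P
  exact h.of_map (f := (MulAut.conj g).toMonoidHom) (MulAut.conj g).injective

/-- Sylow-type conjugacy modulo a normal `p'`-subgroup. -/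
theorem exists_mul_mem_normalizer [Finite G] [hp : Fact p.Prime] {M C : Subgroup G} [M.Normal]
    (hM : ∀ x ∈ M, IsPRegular p x) (hC : IsPGroup p C) {x : G}
    (hx : ∀ c ∈ C, x * c * x⁻¹ ∈ C ⊔ M) :
    ∃ n ∈ C ⊔ M, n * x ∈ Subgroup.normalizer (C : Set G) := by
  set N := C ⊔ M
  have hindex : ∀ D : Subgroup G, D ≤ N → Nat.card D = Nat.card C → ¬ p ∣ (D.subgroupOf N).index := by
    intro D hD hcard hdvd
    have h1 : Nat.card (D.subgroupOf N) = Nat.card C := by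
      rw [← hcard]; exact Nat.card_congr (Subgroup.subgroupOfEquivOfLe hD).toEquiv
    have h2 := (D.subgroupOf N).card_mul_index
    have h3 : M.relIndex N ∣ Nat.card C := by
      rw [Subgroup.relIndex_sup_right]; exact M.relIndex_dvd_card C
    have h4 : Nat.card (M.subgroupOf N) = Nat.card M :=
      Nat.card_congr (Subgroup.subgroupOfEquivOfLe le_sup_right).toEquiv
    have h5 := (M.subgroupOf N).card_mul_index
    rw [h4] at h5
    have h6 : (D.subgroupOf N).index ∣ Nat.card M := by
      refine Nat.dvd_of_mul_dvd_mul_left (Nat.card_pos (α := C)) ?_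
      rw [← h1, h2, ← h5, h1, mul_comm (Nat.card C)]
      exact Nat.mul_dvd_mul_left _ h3
    exact (Nat.Prime.coprime_iff_not_dvd hp.out).1 (coprime_card_of_isPRegular hM).symm
      (hdvd.trans h6)
  set C' := C.map (MulAut.conj x).toMonoidHom
  have hC' : C' ≤ N := by
    rintro _ ⟨c, hc, rfl⟩
    exact hx c hc
  have hcard' : Nat.card C' = Nat.card C :=
    Subgroup.card_map_of_injective (MulAut.conj x).injective
  let S₁ : Sylow p N := IsPGroup.toSylow
    (hC.comap_of_injective N.subtype N.subtype_injective) (hindex C le_sup_left rfl)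
  let S₂ : Sylow p N := IsPGroup.toSylow
    ((hC.map (MulAut.conj x).toMonoidHom).comap_of_injective N.subtype N.subtype_injective)
    (hindex C' hC' hcard')
  obtain ⟨n, hn⟩ := MulAction.exists_smul_eq N S₂ S₁
  refine ⟨n, n.2, Subgroup.mem_normalizer_fintype fun c hc => ?_⟩
  have h1 : (⟨x * c * x⁻¹, hx c hc⟩ : N) ∈ (S₂ : Subgroup N) := ⟨c, hc, rfl⟩
  have h2 : n * (⟨x * c * x⁻¹, hx c hc⟩ : N) * n⁻¹ ∈ (S₁ : Subgroup N) := by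
    rw [← hn, Sylow.coe_subgroup_smul]
    exact Subgroup.smul_mem_pointwise_smul _ (MulAut.conj n) _ h1
  have h3 : (n : G) * (x * c * x⁻¹) * (n : G)⁻¹ ∈ C := h2
  simpa [mul_assoc] using h3

theorem CharLocallyPNilpotent.quotient [Finite G] [hp : Fact p.Prime] {P M : Subgroup G} [M.Normal]
    (hM : ∀ x ∈ M, IsPRegular p x) (hP : IsPGroup p P) (h : CharLocallyPNilpotent p P) :
    CharLocallyPNilpotent p (P.map (QuotientGroup.mk' M)) := by
  intro D hD hne
  let e : P ≃* P.map (QuotientGroup.mk' M) :=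
    MulEquiv.ofBijective ((QuotientGroup.mk' M).subgroupMap P) ⟨by
      rw [injective_iff_map_eq_one]
      intro x hx
      have h1 : (QuotientGroup.mk' M) x = 1 := congrArg Subtype.val hx
      have h2 : (x : G) ∈ M := (QuotientGroup.eq_one_iff _).1 h1
      exact Subtype.ext ((hM _ h2).eq_one_of_mem hp.out hP x.2),
      (QuotientGroup.mk' M).subgroupMap_surjective P⟩
  set C := D.map e.symm.toMonoidHom
  have hC := hD.map_equiv e.symm
  have h1 := h C hC
    (by rwa [Ne, Subgroup.map_eq_bot_iff_of_injective _ e.symm.injective])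
  have hCD : (C.map P.subtype).map (QuotientGroup.mk' M) =
      D.map (P.map (QuotientGroup.mk' M)).subtype := by
    rw [Subgroup.map_map, Subgroup.map_map]
    congr 1
    ext x
    exact congrArg Subtype.val (e.apply_symm_apply x)
  rw [← hCD]
  set E := C.map P.subtype
  have hE : IsPGroup p E := hP.to_le (Subgroup.map_subtype_le C)
  have hle : Subgroup.normalizer (E.map (QuotientGroup.mk' M) : Set (G ⧸ M)) ≤
      (Subgroup.normalizer (E : Set G)).map (QuotientGroup.mk' M) := by
    intro y hy
    obtain ⟨x, rfl⟩ := QuotientGroup.mk'_surjective M y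
    have hmem : ∀ g, g ∈ E ⊔ M ↔ QuotientGroup.mk' M g ∈ E.map (QuotientGroup.mk' M) := fun g => by
      rw [← Subgroup.mem_comap, Subgroup.comap_map_eq, QuotientGroup.ker_mk']
    obtain ⟨n, hn, hnx⟩ := exists_mul_mem_normalizer hM hE (x := x) fun c hc => by
      rw [hmem, map_mul, map_mul, map_inv]
      exact (Subgroup.mem_normalizer_iff.1 hy _).1 ⟨c, hc, rfl⟩
    have h2 : QuotientGroup.mk' M n ∈ (Subgroup.normalizer (E : Set G)).map (QuotientGroup.mk' M) :=
      Subgroup.map_mono Subgroup.le_normalizer ((hmem n).1 hn)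
    have h3 : QuotientGroup.mk' M (n * x) ∈
      (Subgroup.normalizer (E : Set G)).map (QuotientGroup.mk' M) := ⟨_, hnx, rfl⟩
    rw [map_mul] at h3
    exact (Subgroup.mul_mem_cancel_left _ h2).1 h3
  exact (h1.of_surjective hp.out
    ((QuotientGroup.mk' M).subgroupMap_surjective (Subgroup.normalizer (E : Set G)))).mono hle

end CharLocal

section Structure

variable {G : Type*} [Group G] {p : ℕ}

theorem IsPRegular.mul_of_commute {x y : G} (hx : IsPRegular p x) (hy : IsPRegular p y)
    (h : Commute x y) : IsPRegular p (x * y) :=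
  Nat.Coprime.coprime_dvd_left (h.orderOf_mul_dvd_mul_orderOf) (Nat.Coprime.mul_left hx hy)

theorem IsPRegular.pow {x : G} (hx : IsPRegular p x) (n : ℕ) : IsPRegular p (x ^ n) :=
  Nat.Coprime.coprime_dvd_left (orderOf_pow_dvd n) hx

theorem isPNilpotent_of_le_center [Finite G] {Z : Subgroup G} (hZ : Z ≤ Subgroup.center G)
    (hindex : Z.index.Coprime p) : IsPNilpotent p G := by
  intro x y hx hy
  set n := (Subgroup.center G).index
  have hn : n.Coprime p := Nat.Coprime.coprime_dvd_left (Subgroup.index_dvd_of_le hZ) hindex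
  have h1 : ∀ g : G, g ^ n ∈ Subgroup.center G := fun g =>
    MonoidHom.transferCenterPow_apply g ▸ (MonoidHom.transferCenterPow G g).2
  have h2 : (x * y) ^ n = x ^ n * y ^ n := by
    have := congrArg Subtype.val (map_mul (MonoidHom.transferCenterPow G) x y)
    rwa [Subgroup.coe_mul, MonoidHom.transferCenterPow_apply, MonoidHom.transferCenterPow_apply,
      MonoidHom.transferCenterPow_apply] at this
  have h3 : IsPRegular p ((x * y) ^ n) := by
    rw [h2]
    exact (hx.pow n).mul_of_commute (hy.pow n) ((Subgroup.mem_center_iff.1 (h1 y) _))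
  refine isPRegular_of_pow_eq_one (n := n * orderOf ((x * y) ^ n)) (Nat.Coprime.mul_left hn h3) ?_
  rw [pow_mul, pow_orderOf_eq_one]

theorem eq_one_of_isPRegular_of_centralizer [Finite G] [hp : Fact p.Prime] {X : Subgroup G}
    [hX : X.Normal] (hq : IsPNilpotent p (G ⧸ X))
    (hO : ∀ M : Subgroup G, M.Normal → (∀ x ∈ M, IsPRegular p x) → M = ⊥) {c : G}
    (hc : IsPRegular p c) (hcX : ∀ x ∈ X, Commute x c) : c = 1 := by
  let C₀ : Subgroup G := Subgroup.centralizer (X : Set G) ⊓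
    hq.complement.comap (QuotientGroup.mk' X)
  have hC₀ : ∀ g, g ∈ C₀ ↔ (∀ x ∈ X, Commute x g) ∧ IsPRegular p (g : G ⧸ X) := fun g => by
    rw [Subgroup.mem_inf, Subgroup.mem_centralizer_iff]
    rfl
  have hC₀n : C₀.Normal := inferInstance
  have hnil : IsPNilpotent p C₀ := by
    refine isPNilpotent_of_le_center (Z := X.subgroupOf C₀) ?_ ?_
    · intro z hz
      rw [Subgroup.mem_center_iff]
      intro g
      exact Subtype.ext (((hC₀ _).1 g.2).1 z hz).symm.eq
    · let f : C₀ →* hq.complement := ((QuotientGroup.mk' X).comp C₀.subtype).codRestrict _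
        fun g => ((hC₀ g).1 g.2).2
      have hker : X.subgroupOf C₀ = f.ker := by
        ext g
        rw [Subgroup.mem_subgroupOf, MonoidHom.mem_ker, Subtype.ext_iff]
        exact (QuotientGroup.eq_one_iff _).symm
      rw [hker, Subgroup.index_ker]
      exact Nat.Coprime.coprime_dvd_left (Subgroup.card_subgroup_dvd_card _)
        (coprime_card_of_isPRegular fun x hx => hx)
  let M : Subgroup G := hnil.complement.map C₀.subtype
  have hM : ∀ g, g ∈ M ↔ g ∈ C₀ ∧ IsPRegular p g := by
    intro g
    constructor
    · rintro ⟨x, hx, rfl⟩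
      exact ⟨x.2, isPRegular_coe.2 hx⟩
    · rintro ⟨h1, h2⟩
      exact ⟨⟨g, h1⟩, isPRegular_coe.1 h2, rfl⟩
  have hMbot := hO M ⟨fun n hn g => by
    rw [hM] at hn ⊢
    exact ⟨hC₀n.conj_mem _ hn.1 g, hn.2.conj g⟩⟩ fun x hx => ((hM x).1 hx).2
  have : c ∈ M := (hM c).2 ⟨(hC₀ c).2 ⟨hcX, hc.map (QuotientGroup.mk' X)⟩, hc⟩
  rwa [hMbot, Subgroup.mem_bot] at this

/-- A normal `p'`-subgroup on which a `p`-group acts irreducibly is abelian. -/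
theorem commute_of_irreducible [Finite G] [hp : Fact p.Prime] {K P : Subgroup G} [hK : K.Normal]
    (hKp : ∀ x ∈ K, IsPRegular p x) (hP : IsPGroup p P)
    (hirr : ∀ Y ≤ K, (∀ u ∈ P, ∀ y ∈ Y, u * y * u⁻¹ ∈ Y) → Y = ⊥ ∨ Y = K) :
    ∀ x ∈ K, ∀ y ∈ K, Commute x y := by
  by_cases hbot : K = ⊥
  · intro x hx y hy
    rw [hbot, Subgroup.mem_bot] at hx
    rw [hx]; exact Commute.one_left y
  let _ : MulDistribMulAction P K :=
    MulDistribMulAction.compHom K ((MulAut.conjNormal (H := K)).comp P.subtype)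
  have hsmul : ∀ (u : P) (x : K), ((u • x : K) : G) = u * x * (u : G)⁻¹ := fun u x => rfl
  have hcard : Nat.card K ≠ 1 := by rwa [Ne, Subgroup.card_eq_one]
  obtain ⟨q, hq, hqK⟩ := Nat.exists_prime_and_dvd hcard
  have := Fact.mk hq
  have hfix : (MulAction.fixedPoints P (Sylow q K)).Nonempty := by
    refine hP.nonempty_fixed_point_of_prime_not_dvd_card _ fun h => ?_
    obtain ⟨S⟩ : Nonempty (Sylow q K) := inferInstance
    have h1 : p ∣ Nat.card K := h.trans ((S.card_dvd_index).trans (Subgroup.index_dvd_card _))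
    exact (Nat.Prime.coprime_iff_not_dvd hp.out).1 (coprime_card_of_isPRegular hKp).symm h1
  obtain ⟨S, hS⟩ := hfix
  have hSinv : ∀ u ∈ P, ∀ y ∈ (S : Subgroup K).map K.subtype,
      u * y * u⁻¹ ∈ (S : Subgroup K).map K.subtype := by
    rintro u hu _ ⟨y, hy, rfl⟩
    refine ⟨(⟨u, hu⟩ : P) • y, ?_, rfl⟩
    have h1 : ((⟨u, hu⟩ : P) • S : Sylow q K) = S := hS ⟨u, hu⟩
    rw [← h1]
    exact Subgroup.smul_mem_pointwise_smul _ (⟨u, hu⟩ : P) _ hy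
  have hSne : (S : Subgroup K).map K.subtype ≠ ⊥ := by
    rw [Ne, Subgroup.map_eq_bot_iff_of_injective _ K.subtype_injective]
    exact S.ne_bot_of_dvd_card hqK
  have hSK := (hirr _ (Subgroup.map_subtype_le _) hSinv).resolve_left hSne
  have hKq : IsPGroup q K := by
    rw [← hSK]
    exact S.isPGroup'.map _
  have hnt : Nontrivial K := (Subgroup.nontrivial_iff_ne_bot _).2 hbot
  have hcen := hKq.center_nontrivial
  have hZinv : ∀ u ∈ P, ∀ y ∈ (Subgroup.center K).map K.subtype,
      u * y * u⁻¹ ∈ (Subgroup.center K).map K.subtype := by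
    rintro u hu _ ⟨y, hy, rfl⟩
    refine ⟨MulAut.conjNormal u y, ?_, rfl⟩
    rw [← Subgroup.characteristic_iff_map_eq.1 (Subgroup.centerCharacteristic (G := K))
      (MulAut.conjNormal u)]
    exact ⟨y, hy, rfl⟩
  have hZne : (Subgroup.center K).map K.subtype ≠ ⊥ := by
    rw [Ne, Subgroup.map_eq_bot_iff_of_injective _ K.subtype_injective]
    exact (Subgroup.nontrivial_iff_ne_bot _).1 hcen
  have hZK := (hirr _ (Subgroup.map_subtype_le _) hZinv).resolve_left hZne
  intro x hx y hy
  rw [← hZK] at hy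
  obtain ⟨z, hz, rfl⟩ := hy
  exact congrArg Subtype.val (Subgroup.mem_center_iff.1 hz ⟨x, hx⟩)

end Structure

section Thompson

universe u

variable {G : Type u} [Group G] {p : ℕ}

/-- A nontrivial normal `p`-subgroup in a minimal counterexample to Thompson's theorem. -/
theorem exists_normal_of_not_isPNilpotent [Finite G] [hp : Fact p.Prime]
    (IH : ∀ (G' : Type u) [Group G'] [Finite G'], Nat.card G' < Nat.card G →
      ∀ P : Sylow p G', CharLocallyPNilpotent p (P : Subgroup G') → IsPNilpotent p G')
    (P : Sylow p G) (h : CharLocallyPNilpotent p (P : Subgroup G)) (hG : ¬ IsPNilpotent p G) :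
    ∃ X : Subgroup G, X.Normal ∧ IsPGroup p X ∧ X ≠ ⊥ ∧
      ∀ K : Subgroup G, IsPGroup p K → X < K → (∃ Q : Sylow p G, (Q : Subgroup G) ≤
        Subgroup.normalizer (K : Set G)) → IsPNilpotent p (Subgroup.normalizer (K : Set G)) := by
  let a : Subgroup G → ℕ := fun X =>
    p ^ (Nat.card (Subgroup.normalizer (X : Set G))).factorization p
  let f : Subgroup G → ℕ := fun X => a X * (Nat.card G + 1) + Nat.card X
  let bad : Set (Subgroup G) := {X | IsPGroup p X ∧ X ≠ ⊥ ∧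
    ¬ IsPNilpotent p (Subgroup.normalizer (X : Set G))}
  have hne : bad.Nonempty := by
    by_contra hne
    refine hG (isPNilpotent_of_normalizer G fun X hX hX1 => ?_)
    by_contra hX2
    exact hne ⟨X, hX, hX1, hX2⟩
  obtain ⟨X, ⟨hXp, hX1, hXbad⟩, hmax⟩ := Set.exists_max_image bad f (Set.toFinite _) hne
  have hcardle : ∀ (S Y : Subgroup G), IsPGroup p S → S ≤ Subgroup.normalizer (Y : Set G) →
      Nat.card S ≤ a Y := by
    intro S Y hS hSY
    obtain ⟨k, hk⟩ := IsPGroup.iff_card.1 hS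
    have h1 : p ^ k ∣ Nat.card (Subgroup.normalizer (Y : Set G)) :=
      hk ▸ Subgroup.card_dvd_of_le hSY
    rw [hk]
    exact Nat.pow_le_pow_right hp.out.pos
      ((hp.out.pow_dvd_iff_le_factorization Nat.card_pos.ne').1 h1)
  have hXn : X.Normal := by
    rw [← Subgroup.normalizer_eq_top_iff]
    by_contra hN
    set N := Subgroup.normalizer (X : Set G)
    obtain ⟨T⟩ : Nonempty (Sylow p N) := inferInstance
    set T' : Subgroup G := (T : Subgroup N).map N.subtype with hT'
    have hT'p : IsPGroup p T' := T.isPGroup'.map _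
    have hT'c : Nat.card T' = a X := by
      rw [hT', Subgroup.card_map_of_injective N.subtype_injective, T.card_eq_multiplicity]
    have hT'loc : CharLocallyPNilpotent p T' := by
      obtain ⟨S, hS⟩ := hT'p.exists_le_sylow
      rcases hS.eq_or_lt with heq | hlt
      · rw [heq]; exact h.sylow S
      · intro C hC hCne
        by_contra hCbad
        obtain ⟨y, hyS, hyN, hyT⟩ := S.isPGroup'.exists_mem_normalizer_notMem hlt
        have hlt' : T' < (S : Subgroup G) ⊓ Subgroup.normalizer (T' : Set G) :=
          lt_of_le_of_ne (le_inf hS Subgroup.le_normalizer) fun e =>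
            hyT (e ▸ Subgroup.mem_inf.2 ⟨hyS, hyN⟩)
        have h1 : Nat.card T' <
            Nat.card ((S : Subgroup G) ⊓ Subgroup.normalizer (T' : Set G) : Subgroup G) :=
          Set.ncard_lt_ncard hlt'
        have h2 := hcardle ((S : Subgroup G) ⊓ Subgroup.normalizer (T' : Set G))
          (C.map T'.subtype) (S.isPGroup'.to_le inf_le_left)
          (inf_le_right.trans (T'.normalizer_le_normalizer_map_of_characteristic C))
        have h3 : f (C.map T'.subtype) ≤ f X := hmax _ ⟨hT'p.to_le (Subgroup.map_subtype_le _), by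
          rwa [Ne, Subgroup.map_eq_bot_iff_of_injective _ T'.subtype_injective], hCbad⟩
        have h4 : Nat.card X ≤ Nat.card G := Subgroup.card_le_card_group X
        have h5 : a X + 1 ≤ a (C.map T'.subtype) := by omega
        have h6 := Nat.mul_le_mul_right (Nat.card G + 1) h5
        rw [add_mul] at h6
        simp only [f] at h3
        omega
    refine hXbad (IH N ?_ T (hT'loc.of_map N.subtype_injective))
    have : Nat.card N < Nat.card (⊤ : Subgroup G) :=
      Set.ncard_lt_ncard (lt_top_iff_ne_top.2 hN : N < ⊤)
    rwa [Subgroup.card_top] at this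
  refine ⟨X, hXn, hXp, hX1, fun K hK hXK ⟨Q, hQ⟩ => ?_⟩
  by_contra hbad
  have h1 : f K ≤ f X := hmax K ⟨hK, fun e => not_lt_bot (e ▸ hXK), hbad⟩
  have h2 : Nat.card X < Nat.card K := Set.ncard_lt_ncard hXK
  have h3 : a X ≤ a K := by
    obtain ⟨k, hk⟩ := IsPGroup.iff_card.1 Q.isPGroup'
    have h4 := hcardle Q K Q.isPGroup' hQ
    have h5 : a X = Nat.card Q := by
      rw [Q.card_eq_multiplicity]
      simp only [a, Subgroup.normalizer_eq_top_iff.2 hXn, Subgroup.card_top]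
    exact h5.trans_le h4
  have h4 := Nat.mul_le_mul_right (Nat.card G + 1) h3
  simp only [f] at h1
  omega

end Thompson

section Thompson

universe u

variable {G : Type u} [Group G] {p : ℕ}

/-- The structure of a minimal counterexample to Thompson's theorem. -/
theorem exists_structure_of_not_isPNilpotent [Finite G] [hp : Fact p.Prime]
    (IH : ∀ (G' : Type u) [Group G'] [Finite G'], Nat.card G' < Nat.card G →
      ∀ P : Sylow p G', CharLocallyPNilpotent p (P : Subgroup G') → IsPNilpotent p G')
    (P : Sylow p G) (h : CharLocallyPNilpotent p (P : Subgroup G)) (hG : ¬ IsPNilpotent p G) :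
    ∃ X L : Subgroup G, X.Normal ∧ L.Normal ∧ IsPGroup p X ∧
      (∀ M : Subgroup G, M.Normal → IsPGroup p M → M ≤ X) ∧
      Subgroup.centralizer (X : Set G) ≤ X ∧
      (∀ x ∈ L, ∀ y ∈ L, x * y * (y * x)⁻¹ ∈ X) ∧
      (∀ x ∈ L, ∃ n : ℕ, n.Coprime p ∧ x ^ n ∈ X) ∧
      L ⊔ P = ⊤ ∧ (P : Subgroup G) ≠ ⊤ ∧
      ∀ K : Subgroup G, (P : Subgroup G) ≤ K → K ≠ ⊤ → K = P := by
  have hO : ∀ M : Subgroup G, M.Normal → (∀ x ∈ M, IsPRegular p x) → M = ⊥ := by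
    intro M hM hreg
    by_contra hne
    have hlt : Nat.card (G ⧸ M) < Nat.card G := by
      have h1 : 1 < Nat.card M := (Subgroup.one_lt_card_iff_ne_bot M).2 hne
      have h2 : 0 < Nat.card (G ⧸ M) := Nat.card_pos
      rw [Subgroup.card_eq_card_quotient_mul_card_subgroup M]
      exact lt_mul_of_one_lt_right h2 h1
    refine hG (IsPNilpotent.of_quotient_regular M hreg (IH _ hlt
      (P.mapSurjective (QuotientGroup.mk'_surjective M)) ?_))
    exact CharLocallyPNilpotent.quotient hreg P.isPGroup' h
  obtain ⟨X, hXn, hXp, hX1, hstar⟩ := exists_normal_of_not_isPNilpotent IH P h hG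
  have hXle : ∀ Q : Sylow p G, X ≤ Q := fun Q => hXp.le_sylow_of_normal Q
  have hXmax : ∀ M : Subgroup G, M.Normal → IsPGroup p M → M ≤ X := by
    intro M hM hMp
    by_contra hle
    have h1 : IsPNilpotent p (Subgroup.normalizer ((X ⊔ M : Subgroup G) : Set G)) :=
      hstar (X ⊔ M) (hXp.to_sup_of_normal_right hMp) (left_lt_sup.2 hle)
        ⟨P, by rw [Subgroup.normalizer_eq_top_iff.2 inferInstance]; exact le_top⟩
    rw [Subgroup.normalizer_eq_top_iff.2 inferInstance] at h1
    exact hG (h1.of_injective (f := (Subgroup.topEquiv (G := G)).symm.toMonoidHom)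
      Subgroup.topEquiv.symm.injective)
  have hq : IsPNilpotent p (G ⧸ X) := by
    have hlt : Nat.card (G ⧸ X) < Nat.card G := by
      have h1 : 1 < Nat.card X := (Subgroup.one_lt_card_iff_ne_bot X).2 hX1
      have h2 : 0 < Nat.card (G ⧸ X) := Nat.card_pos
      rw [Subgroup.card_eq_card_quotient_mul_card_subgroup X]
      exact lt_mul_of_one_lt_right h2 h1
    have hsurj := QuotientGroup.mk'_surjective X
    suffices hloc : ∀ Q : Subgroup (G ⧸ X), IsPGroup p Q →
        (P : Subgroup G).map (QuotientGroup.mk' X) ≤ Q → CharLocallyPNilpotent p Q from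
      IH _ hlt (P.mapSurjective hsurj) (hloc _ (P.mapSurjective hsurj).isPGroup' le_rfl)
    intro Q hQ hPQ C hC hne
    set D := C.map Q.subtype with hD
    have hDp : IsPGroup p D := hQ.to_le (Subgroup.map_subtype_le _)
    have hDne : D ≠ ⊥ := by rwa [Ne, Subgroup.map_eq_bot_iff_of_injective _ Q.subtype_injective]
    have hcomap := Subgroup.comap_normalizer_eq_of_surjective D hsurj
    have h1 := hstar (D.comap (QuotientGroup.mk' X))
      (hDp.comap_of_ker_isPGroup _ (by rwa [QuotientGroup.ker_mk'])) ?_ ⟨P, ?_⟩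
    · rw [← hcomap] at h1
      exact h1.of_surjective hp.out (f := (QuotientGroup.mk' X).subgroupComap
          (Subgroup.normalizer (D : Set (G ⧸ X))))
        (MonoidHom.subgroupComap_surjective_of_surjective _ _ hsurj)
    · have h2 : X = (⊥ : Subgroup (G ⧸ X)).comap (QuotientGroup.mk' X) := by
        rw [MonoidHom.comap_bot, QuotientGroup.ker_mk']
      conv_lhs => rw [h2]
      exact (Subgroup.comap_lt_comap_of_surjective hsurj).2 (bot_lt_iff_ne_bot.2 hDne)
    · rw [← hcomap, ← Subgroup.map_le_iff_le_comap]
      exact hPQ.trans (Q.le_normalizer_map_of_characteristic C)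
  have hreg : ∀ c : G, IsPRegular p c → (∀ x ∈ X, Commute x c) → c = 1 := fun c hc hcX =>
    eq_one_of_isPRegular_of_centralizer hq hO hc hcX
  have hcent : Subgroup.centralizer (X : Set G) ≤ X := by
    refine hXmax _ inferInstance (isPGroup_of_isPRegular_eq_one hp.out fun c hc => ?_)
    exact Subtype.ext (hreg c (isPRegular_coe.2 hc) fun x hx =>
      Subgroup.mem_centralizer_iff.1 c.2 x hx)
  have hnil : ∀ K : Subgroup G, X ≤ K → IsPNilpotent p K → IsPGroup p K := by
    intro K hXK hK
    refine isPGroup_of_isPRegular_eq_one hp.out fun c hc => ?_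
    refine Subtype.ext (hreg c (isPRegular_coe.2 hc) fun x hx => ?_)
    exact congrArg Subtype.val (hK.commute hp.out (X := X.subgroupOf K)
      (hXp.comap_of_injective _ K.subtype_injective) (x := ⟨x, hXK hx⟩)
      (Subgroup.mem_subgroupOf.2 hx) hc).eq
  have hKP : ∀ K : Subgroup G, (P : Subgroup G) ≤ K → K ≠ ⊤ → K = P := by
    intro K hPK hK
    have hlt : Nat.card K < Nat.card (⊤ : Subgroup G) :=
      Set.ncard_lt_ncard (lt_top_iff_ne_top.2 hK : K < ⊤)
    rw [Subgroup.card_top] at hlt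
    refine P.is_maximal' (hnil K ((hXle P).trans hPK) (IH K hlt (P.subtype hPK) ?_)) hPK
    refine CharLocallyPNilpotent.of_map K.subtype_injective ?_
    rw [Sylow.coe_subtype, Subgroup.subgroupOf_map_subtype, inf_eq_left.2 hPK]
    exact h
  have hPtop : (P : Subgroup G) ≠ ⊤ := by
    intro htop
    have hGp : IsPGroup p G := by
      have := P.isPGroup'
      rw [htop] at this
      exact this.of_equiv Subgroup.topEquiv
    refine hG fun x y hx hy => ?_
    rw [hx.eq_one_of_isPGroup hp.out hGp, hy.eq_one_of_isPGroup hp.out hGp, mul_one]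
    exact isPRegular_one
  have habel := commute_of_irreducible (K := hq.complement)
    (P := (P : Subgroup G).map (QuotientGroup.mk' X)) (fun x hx => hx) (P.isPGroup'.map _) (by
      intro Y hY hYinv
      set π := QuotientGroup.mk' X
      have hsurj : Function.Surjective π := QuotientGroup.mk'_surjective X
      have hPn : (P : Subgroup G) ≤ Subgroup.normalizer ((Y.comap π : Subgroup G) : Set G) := by
        rw [← Subgroup.comap_normalizer_eq_of_surjective Y hsurj, ← Subgroup.map_le_iff_le_comap]
        intro u hu
        rw [Subgroup.mem_normalizer_iff]
        refine fun y => ⟨hYinv u hu y, fun hy => ?_⟩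
        simpa [mul_assoc] using hYinv u⁻¹ (inv_mem hu) _ hy
      have hsup : ∀ g ∈ (P : Subgroup G) ⊔ Y.comap π, ∃ u ∈ P, ∃ y ∈ Y.comap π, u * y = g := by
        intro g hg
        rw [← SetLike.mem_coe, Subgroup.coe_mul_of_left_le_normalizer_right _ _ hPn] at hg
        exact hg
      by_cases htop : (P : Subgroup G) ⊔ Y.comap π = ⊤
      · refine Or.inr (le_antisymm hY fun z hz => ?_)
        obtain ⟨g, rfl⟩ := hsurj z
        obtain ⟨u, hu, y, hy, rfl⟩ := hsup g (htop ▸ Subgroup.mem_top g)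
        have h1 : π u ∈ hq.complement := by
          have := mul_mem hz (inv_mem (hY hy))
          rwa [map_mul, mul_inv_cancel_right] at this
        have h2 : π u = 1 := IsPRegular.eq_one_of_mem hp.out (P.isPGroup'.map π) h1 ⟨u, hu, rfl⟩
        rw [map_mul, h2, one_mul]
        exact hy
      · refine Or.inl ((Subgroup.eq_bot_iff_forall _).2 fun z hz => ?_)
        obtain ⟨g, rfl⟩ := hsurj z
        have h1 : g ∈ (P : Subgroup G) := by
          rw [← hKP _ le_sup_left htop]
          exact (le_sup_right : Y.comap π ≤ _) hz
        exact IsPRegular.eq_one_of_mem hp.out (P.isPGroup'.map π) (hY hz) ⟨g, h1, rfl⟩)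
  refine ⟨X, hq.complement.comap (QuotientGroup.mk' X), hXn, inferInstance, hXp, hXmax, hcent,
    ?_, ?_, ?_, hPtop, hKP⟩
  · intro x hx y hy
    rw [← QuotientGroup.eq_one_iff]
    have := (habel _ hx _ hy).eq
    simp only [QuotientGroup.mk'_apply] at this
    rw [QuotientGroup.mk_mul, QuotientGroup.mk_inv, QuotientGroup.mk_mul, QuotientGroup.mk_mul, this,
      mul_inv_cancel]
  · intro x hx
    refine ⟨orderOf (x : G ⧸ X), hx, ?_⟩
    rw [← QuotientGroup.eq_one_iff, QuotientGroup.mk_pow, pow_orderOf_eq_one]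
  · refine (Subgroup.eq_top_iff' _).2 fun g => ?_
    obtain ⟨k, hk, t, ht, e⟩ := hq.exists_mul_eq (P.mapSurjective (QuotientGroup.mk'_surjective X))
      (QuotientGroup.mk' X g)
    obtain ⟨t, ht', rfl⟩ := ht
    rw [← mul_inv_cancel_right g t⁻¹, inv_inv]
    refine Subgroup.mul_mem_sup (x := g * t⁻¹) ?_ ht'
    change IsPRegular p _
    rw [map_mul, ← e, map_inv, mul_inv_cancel_right]
    exact hk

end Thompson

section Thompson

variable {G : Type*} [Group G] {p : ℕ}

theorem Subgroup.card_mul_relIndex_of_le {H K : Subgroup G} (h : H ≤ K) :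
    Nat.card H * H.relIndex K = Nat.card K := by
  have := Subgroup.relIndex_mul_relIndex ⊥ H K bot_le h
  rwa [Subgroup.relIndex_bot_left, Subgroup.relIndex_bot_left] at this

theorem exists_lt_card_inf_centralizer [Finite G] [hp : Fact p.Prime] (hp2 : p ≠ 2)
    {X V A L : Subgroup G} [V.Normal] [hL : L.Normal]
    (hVc : ∀ v ∈ V, ∀ w ∈ V, Commute v w) (hVp : ∀ v ∈ V, v ^ p = 1)
    (hXV : X ≤ Subgroup.centralizer (V : Set G)) (hVX : Subgroup.centralizer (V : Set G) ≤ X)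
    (hA : IsPGroup p A) (hAc : ∀ a ∈ A, ∀ b ∈ A, Commute a b)
    (hLc : ∀ x ∈ L, ∀ y ∈ L, x * y * (y * x)⁻¹ ∈ X)
    (hLp : ∀ x ∈ L, ∃ n : ℕ, n.Coprime p ∧ x ^ n ∈ X)
    (hne : ∃ a ∈ A, ∃ x ∈ L, a * x * (x * a)⁻¹ ∉ X) :
    ∃ C ≤ A, Nat.card C * p = Nat.card A ∧
      p * Nat.card (V ⊓ Subgroup.centralizer (A : Set G) : Subgroup G) <
        Nat.card (V ⊓ Subgroup.centralizer (C : Set G) : Subgroup G) := by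
  let ρ : G →* MulAut V := MulAut.conjNormal
  have hρ : ∀ (g : G) (v : V), ((ρ g v : V) : G) = g * v * g⁻¹ := fun g v => rfl
  have hρ1 : ∀ (g : G) (v : V), ρ g v = v ↔ Commute g v := fun g v => by
    rw [Subtype.ext_iff, hρ, mul_inv_eq_iff_eq_mul]
    rfl
  have hker : ∀ g, ρ g = 1 ↔ g ∈ X := by
    intro g
    rw [le_antisymm hXV hVX, Subgroup.mem_centralizer_iff]
    constructor
    · intro h v hv
      exact ((hρ1 g ⟨v, hv⟩).1 (by rw [h]; rfl)).symm.eq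
    · intro h
      exact MulEquiv.ext fun v => (hρ1 g v).2 (h v v.2).symm
  let _ : CommGroup V := { (inferInstance : Group V) with
    mul_comm := fun a b => Subtype.ext (hVc a a.2 b b.2).eq }
  let _ : DistribMulAction (MulAut V) (Additive V) :=
    { smul := fun f v => Additive.ofMul (f v.toMul)
      one_smul := fun _ => rfl
      mul_smul := fun _ _ _ => rfl
      smul_zero := fun f => congrArg Additive.ofMul (map_one f)
      smul_add := fun f v w => congrArg Additive.ofMul (map_mul f v.toMul w.toMul) }
  have hsmul : ∀ (f : MulAut V) (v : V), f • Additive.ofMul v = Additive.ofMul (f v) :=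
    fun _ _ => rfl
  obtain ⟨C', hC'A, hC'card, hlt⟩ := exists_lt_card_fixedPoints (V := Additive V) hp2
    (fun v => by
      change Additive.ofMul (v.toMul ^ p) = 0
      rw [show v.toMul ^ p = 1 from Subtype.ext (hVp _ v.toMul.2)]; rfl)
    (A := A.map ρ) (Q := L.map ρ) (hA.map ρ)
    (by
      rintro _ ⟨a, ha, rfl⟩ _ ⟨b, hb, rfl⟩
      exact (hAc a ha b hb).map ρ)
    (by
      rintro _ ⟨x, hx, rfl⟩ _ ⟨y, hy, rfl⟩
      have := (hker _).2 (hLc x hx y hy)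
      rwa [map_mul, map_inv, mul_inv_eq_one, map_mul, map_mul] at this)
    (by
      rintro _ ⟨x, hx, rfl⟩
      obtain ⟨n, hn, hx⟩ := hLp x hx
      exact isPRegular_of_pow_eq_one hn (by rw [← map_pow, hker]; exact hx))
    (by
      rintro _ ⟨a, ha, rfl⟩ _ ⟨x, hx, rfl⟩
      exact ⟨a * x * a⁻¹, hL.conj_mem x hx a, by simp⟩)
    (by
      obtain ⟨a, ha, x, hx, h⟩ := hne
      refine ⟨ρ a, ⟨a, ha, rfl⟩, ρ x, ⟨x, hx, rfl⟩, fun hc => h ((hker _).1 ?_)⟩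
      rw [map_mul, map_inv, mul_inv_eq_one, map_mul, map_mul]
      exact hc.eq)
    (fun x _ h => MulEquiv.ext fun v => h (Additive.ofMul v))
  have hfix : ∀ B : Subgroup G, Nat.card (FixedPoints.addSubgroup (B.map ρ) (Additive V)) =
      Nat.card (V ⊓ Subgroup.centralizer (B : Set G) : Subgroup G) := by
    intro B
    refine Nat.card_congr
      { toFun := fun v => ⟨(v : Additive V).toMul, v.1.toMul.2, ?_⟩
        invFun := fun v => ⟨Additive.ofMul ⟨v, v.2.1⟩, ?_⟩
        left_inv := fun _ => rfl
        right_inv := fun _ => rfl }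
    · refine Subgroup.mem_centralizer_iff.2 ?_
      intro b hb
      exact ((hρ1 b _).1 (v.2 ⟨ρ b, b, hb, rfl⟩)).eq
    · rintro ⟨_, b, hb, rfl⟩
      exact (hρ1 b ⟨v, v.2.1⟩).2 (Subgroup.mem_centralizer_iff.1 v.2.2 b hb)
  have hC'map : (A ⊓ C'.comap ρ).map ρ = C' := by
    refine SetLike.ext fun x => ⟨?_, fun hx => ?_⟩
    · rintro ⟨y, hy, rfl⟩
      exact hy.2
    · obtain ⟨y, hy, rfl⟩ := hC'A hx
      exact ⟨y, ⟨hy, hx⟩, rfl⟩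
  refine ⟨A ⊓ C'.comap ρ, inf_le_left, ?_, ?_⟩
  · have h1 : Nat.card C' * C'.relIndex (A.map ρ) = Nat.card (A.map ρ) :=
      Subgroup.card_mul_relIndex_of_le hC'A
    have h2 : C'.relIndex (A.map ρ) = p := by
      rw [← hC'card] at h1
      exact Nat.eq_of_mul_eq_mul_left Nat.card_pos h1
    have h3 : (A ⊓ C'.comap ρ).relIndex A = p := by
      rw [Subgroup.inf_relIndex_left, Subgroup.relIndex_comap, h2]
    rw [← h3, Subgroup.card_mul_relIndex_of_le inf_le_left]
  · rw [← hfix, ← hfix, hC'map]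
    exact hlt

end Thompson

section Thompson

open scoped Pointwise

/-- **Thompson's normal `p`-complement theorem** for odd `p`. -/
theorem CharLocallyPNilpotent.isPNilpotent.{u} {p : ℕ} [hp : Fact p.Prime] (hp2 : p ≠ 2)
    (G : Type u) [Group G] [Finite G] (P : Sylow p G)
    (h : CharLocallyPNilpotent p (P : Subgroup G)) : IsPNilpotent p G := by
  induction hn : Nat.card G using Nat.strong_induction_on generalizing G with
  | _ n ih =>
  subst hn
  by_contra hG
  obtain ⟨X, L, hXn, hLn, hXp, hXmax, hcent, hLc, hLp, hLP, hPtop, hKP⟩ :=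
    exists_structure_of_not_isPNilpotent (fun G' _ _ hlt P h => ih _ hlt G' P h rfl) P h hG
  have hXP : X ≤ P := hXp.le_sylow_of_normal P
  have hPne : (P : Subgroup G) ≠ ⊥ := by
    intro hP
    refine hPtop (top_le_iff.1 ?_)
    have hX : X = ⊥ := le_bot_iff.1 (hP ▸ hXP)
    refine le_trans ?_ (hcent.trans hXP)
    intro g _
    rw [hX, Subgroup.mem_centralizer_iff]
    intro x hx
    rw [SetLike.mem_coe, Subgroup.mem_bot] at hx
    simp [hx]
  have : Nontrivial P := (Subgroup.nontrivial_iff_ne_bot _).2 hPne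
  have hcenP := P.isPGroup'.center_nontrivial
  have hchar : ∀ C : Subgroup P, C.Characteristic → C ≠ ⊥ →
      Subgroup.normalizer (C.map (P : Subgroup G).subtype : Set G) = P := by
    intro C hC hne
    refine hKP _ (Subgroup.le_normalizer_map_of_characteristic _ C) fun htop => hG ?_
    have := h C hC hne
    rw [htop] at this
    exact this.of_injective (f := (Subgroup.topEquiv (G := G)).symm.toMonoidHom)
      Subgroup.topEquiv.symm.injective
  let V : Subgroup G :=
    { carrier := {x | x ∈ X ∧ (∀ y ∈ X, Commute y x) ∧ x ^ p = 1}
      one_mem' := ⟨X.one_mem, fun y _ => Commute.one_right y, one_pow p⟩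
      mul_mem' := fun {a b} ha hb => ⟨X.mul_mem ha.1 hb.1,
        fun y hy => (ha.2.1 y hy).mul_right (hb.2.1 y hy), by
          rw [(hb.2.1 a ha.1).mul_pow, ha.2.2, hb.2.2, one_mul]⟩
      inv_mem' := fun {a} ha => ⟨X.inv_mem ha.1, fun y hy => (ha.2.1 y hy).inv_right, by
        rw [inv_pow, ha.2.2, inv_one]⟩ }
  have hVn : V.Normal := ⟨fun x hx g => ⟨hXn.conj_mem x hx.1 g, fun y hy => by
    have := (hx.2.1 _ (hXn.conj_mem y hy g⁻¹)).map (MulAut.conj g)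
    simpa [mul_assoc] using this, by rw [conj_pow, hx.2.2]; simp⟩⟩
  have hVX : V ≤ X := fun x hx => hx.1
  have hXV : X ≤ Subgroup.centralizer (V : Set G) := fun x hx =>
    Subgroup.mem_centralizer_iff.2 fun v hv => (hv.2.1 x hx).symm.eq
  have hcV : Subgroup.centralizer (V : Set G) ≤ X := by
    let Z : Subgroup P :=
      { carrier := {x | x ∈ Subgroup.center P ∧ x ^ p = 1}
        one_mem' := ⟨Subgroup.one_mem _, one_pow p⟩
        mul_mem' := fun {a b} ha hb => ⟨Subgroup.mul_mem _ ha.1 hb.1, by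
          rw [Commute.mul_pow (Subgroup.mem_center_iff.1 hb.1 a), ha.2, hb.2, one_mul]⟩
        inv_mem' := fun {a} ha => ⟨Subgroup.inv_mem _ ha.1, by rw [inv_pow, ha.2, inv_one]⟩ }
    have hZc : Z.Characteristic := by
      rw [Subgroup.characteristic_iff_map_le]
      rintro φ _ ⟨z, hz, rfl⟩
      refine ⟨?_, by rw [← map_pow]; exact (congrArg φ hz.2).trans (map_one φ)⟩
      rw [← Subgroup.characteristic_iff_map_eq.1 (Subgroup.centerCharacteristic (G := P)) φ]
      exact ⟨z, hz.1, rfl⟩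
    have hZne : Z ≠ ⊥ := by
      have hd : p ∣ Nat.card (Subgroup.center P) := by
        obtain ⟨k, hk⟩ := IsPGroup.iff_card.1 (P.isPGroup'.to_subgroup (Subgroup.center P))
        rw [hk]
        refine dvd_pow_self p fun hk0 => ?_
        rw [hk0, pow_zero] at hk
        exact (Finite.one_lt_card (α := Subgroup.center P)).ne' hk
      obtain ⟨z, hz⟩ := exists_prime_orderOf_dvd_card' p hd
      intro hZ
      have hzZ : (z : P) ∈ Z := ⟨z.2, by
        have := pow_orderOf_eq_one z
        rw [hz] at this
        exact congrArg Subtype.val this⟩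
      rw [hZ, Subgroup.mem_bot] at hzZ
      rw [show z = 1 from Subtype.ext hzZ, orderOf_one] at hz
      exact hp.out.one_lt.ne hz
    have hZV : Z.map (P : Subgroup G).subtype ≤ V := by
      rintro _ ⟨z, hz, rfl⟩
      have hz1 : ∀ y ∈ X, Commute y (z : G) := fun y hy =>
        congrArg Subtype.val (Subgroup.mem_center_iff.1 hz.1 ⟨y, hXP hy⟩)
      exact ⟨hcent (Subgroup.mem_centralizer_iff.2 fun y hy => (hz1 y hy).eq), hz1,
        congrArg Subtype.val hz.2⟩
    refine hXmax _ inferInstance (P.isPGroup'.to_le ?_)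
    rw [← hchar Z hZc hZne]
    exact (Subgroup.centralizer_le hZV).trans (Subgroup.centralizer_le_normalizer _)
  obtain ⟨A, hAP, hAc, hAmax, hAX⟩ : ∃ A : Subgroup G, A ≤ P ∧ (∀ a ∈ A, ∀ b ∈ A, Commute a b) ∧
      (∀ B ≤ (P : Subgroup G), (∀ a ∈ B, ∀ b ∈ B, Commute a b) → Nat.card B ≤ Nat.card A) ∧
      ¬ A ≤ X := by
    obtain ⟨M, hMc, hMmax⟩ := Set.exists_max_image
      {B : Subgroup P | ∀ a ∈ B, ∀ b ∈ B, Commute a b} (fun B => Nat.card B) (Set.toFinite _)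
      ⟨⊥, fun a ha b _ => by rw [Subgroup.mem_bot.1 ha]; exact Commute.one_left b⟩
    let S : Set (Subgroup P) := {B | (∀ a ∈ B, ∀ b ∈ B, Commute a b) ∧ Nat.card B = Nat.card M}
    obtain ⟨B, hB, hBX⟩ : ∃ B ∈ S, ¬ B.map (P : Subgroup G).subtype ≤ X := by
      by_contra! hcon
      have hJc : (sSup S).Characteristic := by
        rw [Subgroup.characteristic_iff_map_le]
        intro φ
        rw [Subgroup.map_le_iff_le_comap, sSup_le_iff]
        intro B hB
        rw [← Subgroup.map_le_iff_le_comap]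
        refine le_sSup ⟨?_, ?_⟩
        · rintro _ ⟨a, ha, rfl⟩ _ ⟨b, hb, rfl⟩
          exact (hB.1 a ha b hb).map φ
        · rw [Subgroup.card_map_of_injective φ.injective, hB.2]
      have hJne : sSup S ≠ ⊥ := by
        intro hJ
        have h1 : Nat.card (Subgroup.center P) ≤ Nat.card M :=
          hMmax _ fun a _ b hb => Subgroup.mem_center_iff.1 hb a
        have h2 : M ≤ ⊥ := hJ ▸ le_sSup ⟨hMc, rfl⟩
        rw [le_bot_iff.1 h2, Subgroup.card_bot] at h1
        exact (Finite.one_lt_card (α := Subgroup.center P)).not_ge h1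
      have hJn : ((sSup S).map (P : Subgroup G).subtype).Normal := by
        refine ⟨fun n hn g => ?_⟩
        suffices hle : sSup S ≤ (((sSup S).map (P : Subgroup G).subtype).comap
            (MulAut.conj g).toMonoidHom).comap (P : Subgroup G).subtype by
          obtain ⟨n, hn, rfl⟩ := hn
          exact hle hn
        rw [sSup_le_iff]
        intro B hB b hb
        have hBX := hcon B hB
        have hB'P : (B.map (P : Subgroup G).subtype).map (MulAut.conj g).toMonoidHom ≤ P := by
          rintro _ ⟨x, hx, rfl⟩
          exact hXP (hXn.conj_mem x (hBX hx) g)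
        have hmem : ((B.map (P : Subgroup G).subtype).map
            (MulAut.conj g).toMonoidHom).subgroupOf P ∈ S := by
          constructor
          · rintro ⟨_, _⟩ ⟨_, ⟨a, ha, rfl⟩, rfl⟩ ⟨_, _⟩ ⟨_, ⟨c, hc, rfl⟩, rfl⟩
            refine Subtype.ext ?_
            exact (((hB.1 a ha c hc).map (P : Subgroup G).subtype).map (MulAut.conj g)).eq
          · rw [Nat.card_congr (Subgroup.subgroupOfEquivOfLe hB'P).toEquiv,
              Subgroup.card_map_of_injective (MulAut.conj g).injective,
              Subgroup.card_map_of_injective (P : Subgroup G).subtype_injective, hB.2]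
        have hgb : MulAut.conj g (b : G) ∈
            (B.map (P : Subgroup G).subtype).map (MulAut.conj g).toMonoidHom :=
          ⟨_, ⟨b, hb, rfl⟩, rfl⟩
        exact ⟨⟨_, hB'P hgb⟩, le_sSup hmem (Subgroup.mem_subgroupOf.2 hgb), rfl⟩
      have := hchar _ hJc hJne
      rw [Subgroup.normalizer_eq_top_iff.2 hJn] at this
      exact hPtop this.symm
    refine ⟨B.map (P : Subgroup G).subtype, Subgroup.map_subtype_le _, ?_, ?_, hBX⟩
    · rintro _ ⟨a, ha, rfl⟩ _ ⟨b, hb, rfl⟩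
      exact (hB.1 a ha b hb).map (P : Subgroup G).subtype
    · intro C hCP hCc
      rw [Subgroup.card_map_of_injective (P : Subgroup G).subtype_injective, hB.2,
        ← Nat.card_congr (Subgroup.subgroupOfEquivOfLe hCP).toEquiv]
      exact hMmax _ fun a ha b hb => Subtype.ext
        (hCc a (Subgroup.mem_subgroupOf.1 ha) b (Subgroup.mem_subgroupOf.1 hb)).eq
  have hne : ∃ a ∈ A, ∃ x ∈ L, a * x * (x * a)⁻¹ ∉ X := by
    by_contra! hcon
    let E : Subgroup G := (Subgroup.centralizer
      ((L.map (QuotientGroup.mk' X) : Subgroup (G ⧸ X)) : Set (G ⧸ X))).comap (QuotientGroup.mk' X)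
    have hLX : (L.map (QuotientGroup.mk' X)).Normal :=
      hLn.map _ (QuotientGroup.mk'_surjective X)
    have hEn : E.Normal := inferInstance
    have hE : ∀ g, g ∈ E ↔ ∀ x ∈ L, g * x * (x * g)⁻¹ ∈ X := by
      intro g
      change _ ∈ Subgroup.centralizer _ ↔ _
      rw [Subgroup.mem_centralizer_iff]
      have key : ∀ x : G, g * x * (x * g)⁻¹ ∈ X ↔
          QuotientGroup.mk' X x * QuotientGroup.mk' X g =
            QuotientGroup.mk' X g * QuotientGroup.mk' X x := by
        intro x
        rw [← map_mul, ← map_mul, ← QuotientGroup.eq_one_iff]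
        change QuotientGroup.mk' X (g * x * (x * g)⁻¹) = 1 ↔ _
        rw [map_mul (QuotientGroup.mk' X) (g * x), map_inv, mul_inv_eq_one]
        exact eq_comm
      constructor
      · exact fun hg x hx => (key x).2 (hg _ ⟨x, hx, rfl⟩)
      · rintro hg _ ⟨x, hx, rfl⟩
        exact (key x).1 (hg x hx)
    have hDn : ((P : Subgroup G) ⊓ E).Normal := by
      rw [← Subgroup.normalizer_eq_top_iff, ← top_le_iff, ← hLP, sup_le_iff]
      have aux : ∀ K : Subgroup G, (∀ u ∈ K, ∀ d ∈ (P : Subgroup G) ⊓ E, u * d * u⁻¹ ∈ P) →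
          K ≤ Subgroup.normalizer (((P : Subgroup G) ⊓ E : Subgroup G) : Set G) := by
        intro K hK
        have aux2 : ∀ u ∈ K, ∀ d ∈ (P : Subgroup G) ⊓ E, u * d * u⁻¹ ∈ (P : Subgroup G) ⊓ E :=
          fun u hu d hd => ⟨hK u hu d hd, hEn.conj_mem d hd.2 u⟩
        intro u hu
        rw [Subgroup.mem_normalizer_iff]
        refine fun d => ⟨aux2 u hu d, fun hd => ?_⟩
        simpa [mul_assoc] using aux2 u⁻¹ (inv_mem hu) _ hd
      refine ⟨aux _ fun l hl d hd => ?_, aux _ fun u hu d hd =>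
        (P : Subgroup G).mul_mem ((P : Subgroup G).mul_mem hu hd.1) ((P : Subgroup G).inv_mem hu)⟩
      have h1 := hXP (X.inv_mem ((hE d).1 hd.2 l hl))
      have h2 := (P : Subgroup G).mul_mem h1 hd.1
      rwa [mul_inv_rev, inv_inv, mul_inv_rev, ← mul_assoc, inv_mul_cancel_right] at h2
    refine hAX (le_trans (le_inf hAP fun a ha => (hE a).2 (hcon a ha)) (hXmax _ hDn ?_))
    exact P.isPGroup'.to_le inf_le_left
  obtain ⟨C, hCA, hCcard, hlt⟩ := exists_lt_card_inf_centralizer (V := V) hp2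
    (fun v hv w hw => hw.2.1 v hv.1) (fun v hv => hv.2.2) hXV hcV (P.isPGroup'.to_le hAP) hAc
    hLc hLp hne
  set F := V ⊓ Subgroup.centralizer (C : Set G)
  have hCF : Nat.card (C ⊔ F : Subgroup G) ≤ Nat.card A := by
    have h1 : C ≤ Subgroup.centralizer (C : Set G) := fun a ha =>
      Subgroup.mem_centralizer_iff.2 fun b hb => (hAc b (hCA hb) a (hCA ha)).eq
    have h2 : F ≤ Subgroup.centralizer (C : Set G) := inf_le_right
    have h3 : F ≤ Subgroup.centralizer (F : Set G) := fun a ha =>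
      Subgroup.mem_centralizer_iff.2 fun b hb => (ha.1.2.1 b hb.1.1).eq
    have h4 : C ⊔ F ≤ Subgroup.centralizer ((C ⊔ F : Subgroup G) : Set G) :=
      sup_le (Subgroup.le_centralizer_iff.1 (sup_le h1 h2))
        (Subgroup.le_centralizer_iff.1 (sup_le (Subgroup.le_centralizer_iff.1 h2) h3))
    exact hAmax _ (sup_le (hCA.trans hAP) (inf_le_left.trans (hVX.trans hXP))) fun a ha b hb =>
      Subgroup.mem_centralizer_iff.1 (h4 hb) a ha
  have h1 : C.relIndex (C ⊔ F) ≤ p := by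
    rw [← Subgroup.card_mul_relIndex_of_le (le_sup_left : C ≤ C ⊔ F), ← hCcard] at hCF
    exact Nat.le_of_mul_le_mul_left hCF Nat.card_pos
  have h2 : C.relIndex F ≤ p := le_trans
    (Subgroup.relIndex_le_of_le_right le_sup_right Subgroup.index_ne_zero_of_finite) h1
  have h3 : Nat.card (C ⊓ F : Subgroup G) ≤
      Nat.card (V ⊓ Subgroup.centralizer (A : Set G) : Subgroup G) := by
    refine Subgroup.card_le_of_le (le_inf (inf_le_right.trans inf_le_left) fun c hc =>
      Subgroup.mem_centralizer_iff.2 fun a ha => (hAc a ha c (hCA hc.1)).eq)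
  have h4 := Subgroup.card_mul_relIndex_of_le (inf_le_right : C ⊓ F ≤ F)
  rw [Subgroup.inf_relIndex_right] at h4
  rw [← h4] at hlt
  have h5 := Nat.mul_le_mul h3 h2
  rw [mul_comm p] at hlt
  omega

end Thompson

section FixedPointFree

open Function

/-- If `σ` has prime order and acts without nontrivial fixed points on `S` and `Q`, then elements
of `S` with trivial `Q`-norm are killed by `|Q|`. -/
theorem pow_card_eq_one_of_prod_eq_one {S Q : Type*} [CommGroup S] [Group Q] [Fintype Q] {r : ℕ}
    (hr : r.Prime) (ρ : Q →* MulAut S) (σ : S →* S) (τ : Q →* Q)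
    (hστ : ∀ x v, σ (ρ x v) = ρ (τ x) (σ v)) (hσ : ∀ v, σ v = v → v = 1) (hσr : ∀ v, σ^[r] v = v)
    (hτ : ∀ x, τ x = x → x = 1) (hτr : ∀ x, τ^[r] x = x) {v : S} (hv : ∏ x, ρ x v = 1) :
    v ^ Fintype.card Q = 1 := by
  have hit : ∀ i x v, σ^[i] (ρ x v) = ρ (τ^[i] x) (σ^[i] v) := by
    intro i
    induction i with
    | zero => intro x v; rfl
    | succ i ih => intro x v; rw [iterate_succ_apply, hστ, ih]; rfl
  have hτi : ∀ i, 0 < i → i < r → ∀ x, τ^[i] x = x → x = 1 := by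
    intro i h0 hi x hx
    refine hτ x ?_
    have h1 : IsPeriodicPt τ (Nat.gcd i r) x := IsPeriodicPt.gcd hx (hτr x)
    have h2 : Nat.gcd i r = 1 :=
      ((Nat.Prime.coprime_iff_not_dvd hr).2 (Nat.not_dvd_of_pos_of_lt h0 hi)).symm
    rwa [h2] at h1
  have hinner : ∀ x : Q, ∏ i ∈ Finset.range r, σ^[i] (ρ x v) = 1 := by
    intro x
    refine hσ _ ?_
    rw [map_prod]
    simp_rw [← iterate_succ_apply' σ]
    have := Finset.prod_range_succ (fun i => σ^[i] (ρ x v)) r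
    rw [Finset.prod_range_succ', hσr] at this
    exact mul_right_cancel this
  have h1 : ∏ i ∈ Finset.range r, ∏ x : Q, ρ x⁻¹ (σ^[i] (ρ x v)) = 1 := by
    rw [Finset.prod_comm]
    refine Finset.prod_eq_one fun x _ => ?_
    rw [← map_prod, hinner, map_one]
  have h2 : ∀ i ∈ Finset.range r, i ≠ 0 → ∏ x : Q, ρ x⁻¹ (σ^[i] (ρ x v)) = 1 := by
    intro i hi h0
    have hbij : Bijective fun x : Q => x⁻¹ * τ^[i] x := by
      rw [← Finite.injective_iff_bijective]
      intro x y hxy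
      have hmul : ∀ a b, τ^[i] (a * b) = τ^[i] a * τ^[i] b := iterate_map_mul τ i
      have hinv : ∀ a, τ^[i] a⁻¹ = (τ^[i] a)⁻¹ := iterate_map_inv τ i
      have h3 := hτi i (Nat.pos_of_ne_zero h0) (Finset.mem_range.1 hi) (y * x⁻¹) (by
        rw [hmul, hinv]
        simp only at hxy
        rw [inv_mul_eq_iff_eq_mul] at hxy
        rw [hxy]; group)
      exact (mul_inv_eq_one.1 h3).symm
    have h3 : ∏ x : Q, ρ x⁻¹ (σ^[i] (ρ x v)) = ∏ x : Q, ρ x (σ^[i] v) := by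
      rw [← hbij.prod_comp (fun x => ρ x (σ^[i] v))]
      refine Finset.prod_congr rfl fun x _ => ?_
      rw [hit, map_mul]; rfl
    have hbij2 : Bijective τ^[i] := by
      rw [← Finite.injective_iff_bijective]
      refine Injective.iterate ?_ i
      exact Injective.of_comp (f := τ^[r - 1]) (by
        rw [← iterate_succ, Nat.succ_eq_add_one, Nat.sub_add_cancel hr.pos]
        intro x y hxy; rwa [hτr, hτr] at hxy)
    rw [h3, ← hbij2.prod_comp (fun x => ρ x (σ^[i] v))]
    simp_rw [← hit]
    have hprod : ∀ (j : ℕ) (g : Q → S), ∏ x, σ^[j] (g x) = σ^[j] (∏ x, g x) := by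
      intro j
      induction j with
      | zero => intro g; rfl
      | succ j ih => intro g; simp_rw [iterate_succ_apply, ih, map_prod]
    rw [hprod, hv, iterate_map_one]
  rw [Finset.prod_eq_single_of_mem 0 (Finset.mem_range.2 hr.pos) h2] at h1
  simpa [← MulAut.mul_apply, ← map_mul] using h1

end FixedPointFree

section FixedPointFree

open Function

variable {N : Type*} [Group N] {σ : N →* N}

/-- The restriction of an endomorphism to an invariant subgroup. -/
def MonoidHom.restrictInvariant (σ : N →* N) (K : Subgroup N) (h : ∀ x ∈ K, σ x ∈ K) : K →* K :=
  (σ.comp K.subtype).codRestrict K fun x => h x x.2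

theorem MonoidHom.coe_iterate_restrictInvariant (K : Subgroup N) (h : ∀ x ∈ K, σ x ∈ K) (i : ℕ)
    (x : K) : (((σ.restrictInvariant K h)^[i] x : K) : N) = σ^[i] x := by
  induction i generalizing x with
  | zero => rfl
  | succ i ih => rw [iterate_succ_apply, ih]; rfl

theorem FixedPointFree.restrictInvariant (hσ : ∀ x, σ x = x → x = 1) (K : Subgroup N)
    (h : ∀ x ∈ K, σ x ∈ K) (x : K) (hx : σ.restrictInvariant K h x = x) : x = 1 :=
  Subtype.ext (hσ x (congrArg Subtype.val hx))

theorem FixedPointFree.exists_inv_mul_eq [Finite N] (hσ : ∀ x, σ x = x → x = 1) (y : N) :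
    ∃ x, x⁻¹ * σ x = y := by
  obtain ⟨x, hx⟩ := MonoidHom.FixedPointFree.commutatorMap_surjective (φ := σ) hσ y
  refine ⟨x⁻¹, ?_⟩
  rw [inv_inv, map_inv, ← div_eq_mul_inv]
  exact hx

theorem FixedPointFree.quotient [Finite N] (hσ : ∀ x, σ x = x → x = 1) (K : Subgroup N) [K.Normal]
    (h : K ≤ K.comap σ) (x : N ⧸ K) (hx : QuotientGroup.map K K σ h x = x) : x = 1 := by
  obtain ⟨x, rfl⟩ := QuotientGroup.mk_surjective x
  rw [QuotientGroup.map_mk, eq_comm, QuotientGroup.eq] at hx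
  obtain ⟨k, hk⟩ := FixedPointFree.exists_inv_mul_eq
    (FixedPointFree.restrictInvariant hσ K h) ⟨_, hx⟩
  have hk' : (k : N)⁻¹ * σ k = x⁻¹ * σ x := congrArg Subtype.val hk
  have h1 := hσ (x * (k : N)⁻¹) (by
    rw [map_mul, map_inv, mul_inv_eq_iff_eq_mul, mul_assoc, hk', mul_inv_cancel_left])
  rw [QuotientGroup.eq_one_iff, mul_inv_eq_one.1 h1]
  exact k.2

theorem QuotientGroup.iterate_map (K : Subgroup N) [K.Normal] (h : K ≤ K.comap σ) (i : ℕ) (x : N) :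
    (QuotientGroup.map K K σ h)^[i] (x : N ⧸ K) = (σ^[i] x : N) := by
  induction i generalizing x with
  | zero => rfl
  | succ i ih => rw [iterate_succ_apply, QuotientGroup.map_mk, ih]; rfl

theorem injective_of_iterate_eq {r : ℕ} (hr : 0 < r) (hσr : ∀ x, σ^[r] x = x) :
    Injective σ :=
  Injective.of_comp (f := σ^[r - 1]) (by
    rw [← iterate_succ, Nat.succ_eq_add_one, Nat.sub_add_cancel hr]
    intro x y hxy; rwa [hσr, hσr] at hxy)

theorem FixedPointFree.exists_invariant_sylow [Finite N] {p : ℕ} [Fact p.Prime]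
    (hinj : Injective σ) (hσ : ∀ x, σ x = x → x = 1) : ∃ P : Sylow p N, ∀ x ∈ P, σ x ∈ P := by
  obtain ⟨P⟩ : Nonempty (Sylow p N) := inferInstance
  let e : N ≃* N := MulEquiv.ofBijective σ (Finite.injective_iff_bijective.1 hinj)
  obtain ⟨y, hy⟩ := MulAction.exists_smul_eq N P (P.mapSurjective e.surjective)
  obtain ⟨x, hx⟩ := FixedPointFree.exists_inv_mul_eq hσ y⁻¹
  have hmem : ∀ g z : N, z ∈ g • P ↔ g⁻¹ * z * g ∈ P := by
    intro g z
    change z ∈ ((g • P : Sylow p N) : Subgroup N) ↔ _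
    rw [Sylow.coe_subgroup_smul, Subgroup.mem_pointwise_smul_iff_inv_smul_mem]
    simp [MulAut.smul_def, ← map_inv]
    rfl
  refine ⟨x • P, fun z hz => ?_⟩
  rw [hmem] at hz ⊢
  have h1 : σ (x⁻¹ * z * x) ∈ P.mapSurjective e.surjective := ⟨_, hz, rfl⟩
  rw [← hy, hmem] at h1
  have h2 : x * y⁻¹ = σ x := by rw [← hx, mul_inv_cancel_left]
  have h3 : y = (σ x)⁻¹ * x := by rw [← h2]; group
  rw [h3] at h1
  simpa [mul_assoc] using h1

theorem FixedPointFree.commute_of_coprime [Finite N] {r : ℕ} (hr : r.Prime)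
    (hσ : ∀ x, σ x = x → x = 1) (hσr : ∀ x, σ^[r] x = x) {S Q : Subgroup N} [S.Normal]
    (hS : ∀ x ∈ S, σ x ∈ S) (hQ : ∀ x ∈ Q, σ x ∈ Q) (hSc : ∀ x ∈ S, ∀ y ∈ S, Commute x y)
    (hcop : (Nat.card Q).Coprime (Nat.card S)) {x v : N} (hx : x ∈ Q) (hv : v ∈ S) :
    Commute x v := by
  let _ : CommGroup S := { (inferInstance : Group S) with
    mul_comm := fun a b => Subtype.ext (hSc a a.2 b b.2).eq }
  have := Fintype.ofFinite Q
  let ρ : Q →* MulAut S := MulAut.conjNormal.comp Q.subtype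
  have hρ : ∀ (g : Q) (v : S), ((ρ g v : S) : N) = g * v * (g : N)⁻¹ := fun g v => rfl
  let x' : Q := ⟨x, hx⟩
  let v' : S := ⟨v, hv⟩
  have h1 := pow_card_eq_one_of_prod_eq_one hr ρ (σ.restrictInvariant S hS)
    (σ.restrictInvariant Q hQ) (fun g w => Subtype.ext (by
      change σ (g * w * (g : N)⁻¹) = σ g * σ w * (σ g)⁻¹
      simp)) (FixedPointFree.restrictInvariant hσ S hS)
    (fun w => Subtype.ext (by rw [MonoidHom.coe_iterate_restrictInvariant, hσr]))
    (FixedPointFree.restrictInvariant hσ Q hQ)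
    (fun w => Subtype.ext (by rw [MonoidHom.coe_iterate_restrictInvariant, hσr]))
    (v := ρ x' v' / v') (by
      simp_rw [map_div, Finset.prod_div_distrib]
      rw [div_eq_one, ← Fintype.prod_equiv (Equiv.mulRight x') (fun g => ρ (g * x') v')
        (fun g => ρ g v') fun _ => rfl]
      refine Finset.prod_congr rfl fun g _ => ?_
      rw [map_mul]; rfl)
  rw [← Nat.card_eq_fintype_card] at h1
  have h2 : ρ x' v' / v' = 1 := by
    rw [← orderOf_eq_one_iff]
    exact Nat.eq_one_of_dvd_coprimes hcop (orderOf_dvd_of_pow_eq_one h1) (orderOf_dvd_natCard _)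
  have h3 := congrArg Subtype.val (div_eq_one.1 h2)
  rw [hρ, mul_inv_eq_iff_eq_mul] at h3
  exact h3

end FixedPointFree

section FixedPointFree

open Function

theorem IsPGroup.isPNilpotent {N : Type*} [Group N] {p q : ℕ} [hp : Fact p.Prime] (hq : q.Prime)
    (hN : IsPGroup p N) : IsPNilpotent q N := by
  intro x y hx hy
  by_cases hpq : p = q
  · subst hpq
    rw [hx.eq_one_of_isPGroup hq hN, hy.eq_one_of_isPGroup hq hN, mul_one]
    exact isPRegular_one
  · obtain ⟨k, hk⟩ := IsPGroup.iff_orderOf.1 hN (x * y)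
    rw [IsPRegular, hk]
    exact Nat.Coprime.pow_left k ((Nat.coprime_primes hp.out hq).2 hpq)

theorem isSolvable_of_forall_isPNilpotent (N : Type*) [Group N] [Finite N]
    (h : ∀ p, p.Prime → IsPNilpotent p N) : Group.IsSolvable N := by
  induction hn : Nat.card N using Nat.strong_induction_on generalizing N with
  | _ n ih =>
  subst hn
  by_cases h1 : Nat.card N = 1
  · have := (Nat.card_eq_one_iff_unique.1 h1).1
    infer_instance
  obtain ⟨p, hp, hpN⟩ := Nat.exists_prime_and_dvd h1
  have := Fact.mk hp
  have hlt : Nat.card (h p hp).complement < Nat.card N := by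
    refine lt_of_le_of_ne (Subgroup.card_le_card_group _) fun e => ?_
    have := coprime_card_of_isPRegular (Q := (h p hp).complement) (p := p) fun x hx => hx
    rw [e] at this
    exact (Nat.Prime.coprime_iff_not_dvd hp).1 this.symm hpN
  have h2 := ih _ hlt (h p hp).complement
    (fun q hq => (h q hq).of_injective (Subgroup.subtype_injective _)) rfl
  have h3 := ((h p hp).isPGroup_quotient hp).isNilpotent
  exact Group.isSolvable_of_ker_le_range (h p hp).complement.subtype
    (QuotientGroup.mk' (h p hp).complement) (by
    rw [QuotientGroup.ker_mk', Subgroup.range_subtype])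

/-- **Thompson**: a finite group with a fixed-point-free automorphism of prime order is
`p`-nilpotent for all primes `p`. -/
theorem isPNilpotent_of_fixedPointFree.{u} {r : ℕ} (hr : r.Prime) (N : Type u) [Group N] [Finite N]
    (σ : N →* N) (hσ : ∀ x, σ x = x → x = 1) (hσr : ∀ x, σ^[r] x = x) :
    ∀ p, p.Prime → IsPNilpotent p N := by
  induction hn : Nat.card N using Nat.strong_induction_on generalizing N with
  | _ n ih =>
  subst hn
  by_contra hN
  have hsub : ∀ K : Subgroup N, (∀ x ∈ K, σ x ∈ K) → K ≠ ⊤ → ∀ p, p.Prime → IsPNilpotent p K := by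
    intro K hK hKtop
    have hlt : Nat.card K < Nat.card (⊤ : Subgroup N) :=
      Set.ncard_lt_ncard (lt_top_iff_ne_top.2 hKtop : K < ⊤)
    rw [Subgroup.card_top] at hlt
    exact ih _ hlt K (σ.restrictInvariant K hK) (FixedPointFree.restrictInvariant hσ K hK)
      (fun w => Subtype.ext (by rw [MonoidHom.coe_iterate_restrictInvariant, hσr])) rfl
  have hinj := injective_of_iterate_eq hr.pos hσr
  have hnotp : ∀ p, p.Prime → ¬ IsPGroup p N := fun p hp h =>
    have := Fact.mk hp
    hN fun q hq => h.isPNilpotent hq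
  obtain ⟨M₀, hM₀n, hM₀σ, hM₀b, hM₀t⟩ : ∃ M : Subgroup N, M.Normal ∧ (∀ x ∈ M, σ x ∈ M) ∧
      M ≠ ⊥ ∧ M ≠ ⊤ := by
    obtain ⟨p, hp, hpN, hp2⟩ : ∃ p, p.Prime ∧ p ∣ Nat.card N ∧ p ≠ 2 := by
      by_contra! hcon
      have h1 := Nat.eq_prime_pow_of_unique_prime_dvd (p := 2) (n := Nat.card N)
        Nat.card_pos.ne' fun {d} hd hdN => hcon d hd hdN
      exact hnotp 2 Nat.prime_two (IsPGroup.of_card h1)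
    have := Fact.mk hp
    obtain ⟨P, hP⟩ := FixedPointFree.exists_invariant_sylow (p := p) hinj hσ
    by_cases hloc : CharLocallyPNilpotent p (P : Subgroup N)
    · have hnil := hloc.isPNilpotent hp2 N P
      refine ⟨hnil.complement, inferInstance, fun x hx => IsPRegular.map hx σ, fun hb => ?_,
        fun ht => ?_⟩
      · refine hnotp p hp (isPGroup_of_isPRegular_eq_one hp fun x hx => ?_)
        have : x ∈ hnil.complement := hx
        rwa [hb, Subgroup.mem_bot] at this
      · refine P.ne_bot_of_dvd_card hpN ((Subgroup.eq_bot_iff_forall _).2 fun x hx => ?_)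
        have : IsPRegular p x := hnil.mem_complement.1 (ht ▸ Subgroup.mem_top x)
        exact this.eq_one_of_mem hp P.isPGroup' hx
    · unfold CharLocallyPNilpotent at hloc
      push Not at hloc
      obtain ⟨C, hC, hCne, hCbad⟩ := hloc
      let e : P ≃* P := MulEquiv.ofBijective (σ.restrictInvariant (P : Subgroup N) hP)
        (Finite.injective_iff_bijective.1 fun x y hxy =>
          Subtype.ext (hinj (congrArg Subtype.val hxy)))
      set D := C.map (P : Subgroup N).subtype with hD
      have hDp : IsPGroup p D := P.isPGroup'.to_le (Subgroup.map_subtype_le _)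
      have hDmap : D.map σ = D := by
        have h1 := Subgroup.characteristic_iff_map_eq.1 hC e
        rw [hD]
        conv_rhs => rw [← h1]
        rw [Subgroup.map_map, Subgroup.map_map]
        rfl
      have hDσ : ∀ x ∈ D, σ x ∈ D := fun x hx => hDmap ▸ ⟨x, hx, rfl⟩
      have hDtop : Subgroup.normalizer (D : Set N) = ⊤ := by
        by_contra hne
        refine hCbad (hsub _ (fun x hx => ?_) hne p hp)
        rw [← hDmap]
        exact Subgroup.le_normalizer_map σ ⟨x, hx, rfl⟩
      refine ⟨D, Subgroup.normalizer_eq_top_iff.1 hDtop, hDσ, ?_, fun ht => hnotp p hp ?_⟩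
      · rwa [Ne, hD, Subgroup.map_eq_bot_iff_of_injective _ (P : Subgroup N).subtype_injective]
      · rw [ht] at hDp
        exact hDp.of_equiv Subgroup.topEquiv
  obtain ⟨S, ⟨hSn, hSσ, hSb, hSt⟩, hSmin⟩ := Set.exists_min_image
    {M : Subgroup N | M.Normal ∧ (∀ x ∈ M, σ x ∈ M) ∧ M ≠ ⊥ ∧ M ≠ ⊤} (fun M => Nat.card M)
    (Set.toFinite _) ⟨M₀, hM₀n, hM₀σ, hM₀b, hM₀t⟩
  have hmin : ∀ Y ≤ S, Y.Normal → (∀ x ∈ Y, σ x ∈ Y) → Y ≠ ⊥ → Y = S := by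
    intro Y hYS hYn hYσ hYb
    exact Subgroup.eq_of_le_of_card_ge hYS
      (hSmin Y ⟨hYn, hYσ, hYb, fun h => hSt (top_le_iff.1 (h ▸ hYS))⟩)
  have hSnil := hsub S hSσ hSt
  have hSsol := isSolvable_of_forall_isPNilpotent S hSnil
  have hSnt : Nontrivial S := (Subgroup.nontrivial_iff_ne_bot _).2 hSb
  have hSc : ∀ x ∈ S, ∀ y ∈ S, Commute x y := by
    have h1 : ⁅S, S⁆ = ⊥ := by
      by_contra hne
      have h2 := hmin ⁅S, S⁆ (Subgroup.commutator_le_left S S) inferInstance (fun x hx => ?_) hne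
      · have h3 := Group.IsSolvable.commutator_lt_top_of_nontrivial S
        refine h3.ne ?_
        rw [← Subgroup.map_subtype_commutator] at h2
        exact Subgroup.map_injective S.subtype_injective
          (h2.trans (by rw [← MonoidHom.range_eq_map, Subgroup.range_subtype]))
      · have h3 : σ x ∈ ⁅S, S⁆.map σ := ⟨x, hx, rfl⟩
        rw [Subgroup.map_commutator] at h3
        have h4 : S.map σ ≤ S := by rintro _ ⟨y, hy, rfl⟩; exact hSσ y hy
        exact Subgroup.commutator_mono h4 h4 h3
    intro x hx y hy
    rw [Subgroup.commutator_eq_bot_iff_le_centralizer] at h1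
    exact Subgroup.mem_centralizer_iff.1 (h1 hy) x hx
  obtain ⟨s, hs, hsS⟩ := Nat.exists_prime_and_dvd (n := Nat.card S) fun h =>
    hSb (Subgroup.card_eq_one.1 h)
  have := Fact.mk hs
  have hSexp : ∀ x ∈ S, x ^ s = 1 := by
    let Y : Subgroup N :=
      { carrier := {x | x ∈ S ∧ x ^ s = 1}
        one_mem' := ⟨S.one_mem, one_pow s⟩
        mul_mem' := fun {a b} ha hb => ⟨S.mul_mem ha.1 hb.1, by
          rw [(hSc a ha.1 b hb.1).mul_pow, ha.2, hb.2, one_mul]⟩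
        inv_mem' := fun {a} ha => ⟨S.inv_mem ha.1, by rw [inv_pow, ha.2, inv_one]⟩ }
    have hY : Y = S := by
      refine hmin Y (fun x hx => hx.1) ⟨fun x hx g => ⟨hSn.conj_mem x hx.1 g, by
        rw [conj_pow, hx.2]; simp⟩⟩ (fun x hx => ⟨hSσ x hx.1, by
        rw [← map_pow, hx.2, map_one]⟩) fun hb => ?_
      obtain ⟨z, hz⟩ := exists_prime_orderOf_dvd_card' s hsS
      have hzY : (z : N) ∈ Y := ⟨z.2, by
        have := pow_orderOf_eq_one z
        rw [hz] at this
        exact congrArg Subtype.val this⟩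
      rw [hb, Subgroup.mem_bot] at hzY
      rw [show z = 1 from Subtype.ext hzY, orderOf_one] at hz
      exact hs.one_lt.ne hz
    intro x hx
    rw [← hY] at hx
    exact hx.2
  have hSp : IsPGroup s S := fun x => ⟨1, by
    rw [pow_one]; exact Subtype.ext (hSexp x x.2)⟩
  have hquot : ∀ p, p.Prime → IsPNilpotent p (N ⧸ S) := by
    have hlt : Nat.card (N ⧸ S) < Nat.card N := by
      have h1 : 1 < Nat.card S := (Subgroup.one_lt_card_iff_ne_bot S).2 hSb
      have h2 : 0 < Nat.card (N ⧸ S) := Nat.card_pos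
      rw [Subgroup.card_eq_card_quotient_mul_card_subgroup S]
      exact lt_mul_of_one_lt_right h2 h1
    have hSσ' : S ≤ S.comap σ := hSσ
    refine ih _ hlt (N ⧸ S) (QuotientGroup.map S S σ hSσ') (FixedPointFree.quotient hσ S hSσ')
      (fun x => ?_) rfl
    obtain ⟨x, rfl⟩ := QuotientGroup.mk_surjective x
    rw [QuotientGroup.iterate_map, hσr]
  refine hN fun q hq => ?_
  by_cases hqs : q = s
  · subst hqs
    have hcent : (Subgroup.centralizer (S : Set N)).index ≠ 0 := Subgroup.index_ne_zero_of_finite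
    have hindex : ∀ {d : ℕ}, d.Prime → d ∣ (Subgroup.centralizer (S : Set N)).index → d = q := by
      intro d hd hdi
      by_contra hdq
      have := Fact.mk hd
      obtain ⟨Q, hQ⟩ := FixedPointFree.exists_invariant_sylow (p := d) hinj hσ
      refine Q.not_dvd_index (hdi.trans (Subgroup.index_dvd_of_le fun x hx =>
        Subgroup.mem_centralizer_iff.2 fun v hv => ?_))
      refine (FixedPointFree.commute_of_coprime hr hσ hσr hSσ hQ hSc ?_ hx hv).symm.eq
      obtain ⟨k, hk⟩ := IsPGroup.iff_card.1 Q.isPGroup'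
      obtain ⟨l, hl⟩ := IsPGroup.iff_card.1 hSp
      rw [hk, hl]
      exact Nat.Coprime.pow _ _ ((Nat.coprime_primes hd hq).2 hdq)
    have hreg : ∀ x : N, IsPRegular q x → x ∈ Subgroup.centralizer (S : Set N) := by
      intro x hx
      have h1 : IsPGroup q (N ⧸ Subgroup.centralizer (S : Set N)) :=
        IsPGroup.of_card (Nat.eq_prime_pow_of_unique_prime_dvd hcent hindex)
      exact (QuotientGroup.eq_one_iff x).1 ((hx.map
        (QuotientGroup.mk' (Subgroup.centralizer (S : Set N)))).eq_one_of_isPGroup hq h1)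
    let R : Subgroup N := Subgroup.centralizer (S : Set N) ⊓
      (hquot q hq).complement.comap (QuotientGroup.mk' S)
    have hR : IsPNilpotent q R := by
      refine isPNilpotent_of_le_center (Z := S.subgroupOf R) ?_ ?_
      · intro z hz
        rw [Subgroup.mem_center_iff]
        intro g
        exact Subtype.ext (Subgroup.mem_centralizer_iff.1 g.2.1 z hz).symm
      · let f : R →* (hquot q hq).complement := ((QuotientGroup.mk' S).comp R.subtype).codRestrict _
          fun g => g.2.2
        have hker : S.subgroupOf R = f.ker := by
          ext g
          rw [Subgroup.mem_subgroupOf, MonoidHom.mem_ker, Subtype.ext_iff]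
          exact (QuotientGroup.eq_one_iff _).symm
        rw [hker, Subgroup.index_ker]
        exact Nat.Coprime.coprime_dvd_left (Subgroup.card_subgroup_dvd_card _)
          (coprime_card_of_isPRegular fun x hx => hx)
    have hmem : ∀ x : N, IsPRegular q x → x ∈ R := fun x hx =>
      ⟨hreg x hx, hx.map (QuotientGroup.mk' S)⟩
    exact fun x y hx hy => isPNilpotent_subgroup_iff.1 hR x (hmem x hx) y (hmem y hy) hx hy
  · refine IsPNilpotent.of_quotient_regular S (fun x hx => ?_) (hquot q hq)
    exact isPRegular_of_pow_eq_one ((Nat.coprime_primes hs hq).2 (Ne.symm hqs)) (hSexp x hx)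

end FixedPointFree

section NormalElement

open scoped Pointwise

/-- A strong form of the normal basis theorem: the matrix of conjugates of some element of `L`
is nonsingular. -/
theorem exists_isUnit_of_smul (D L : Type*) [Group D] [Fintype D] [DecidableEq D] [Field L]
    [MulSemiringAction D L] [FaithfulSMul D L] :
    ∃ θ : L, IsUnit (Matrix.of fun d e : D => (d * e) • θ) := by
  have hgal : IsGalois (FixedPoints.subfield D L) L := ⟨⟩
  let B := IsGalois.normalBasis (FixedPoints.subfield D L) L
  refine ⟨B 1, Matrix.vecMul_injective_iff_isUnit.1 ?_⟩
  refine (injective_iff_map_eq_zero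
    (Matrix.of fun d e : D => (d * e) • B 1).vecMulLinear).2 fun c hc => ?_
  have hT : ∑ d, c d • (MulSemiringAction.toAlgAut D (FixedPoints.subfield D L) L d).toLinearMap
      = 0 := by
    refine B.ext fun s => ?_
    obtain ⟨e, rfl⟩ := (FixedPoints.toAlgAut_bijective D L).2 s
    rw [IsGalois.normalBasis_apply]
    have h1 := congrFun hc e
    simp only [Matrix.vecMulLinear_apply, Matrix.vecMul, dotProduct, Matrix.of_apply,
      mul_smul] at h1
    simpa using h1
  have hli : LinearIndependent L fun d : D => (MulSemiringAction.toRingHom D L d : L → L) :=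
    (linearIndependent_monoidHom L L).comp
      (fun d : D => ((MulSemiringAction.toRingHom D L d : L →+* L) : L →* L))
      fun a b hab => FaithfulSMul.eq_of_smul_eq_smul (α := L) fun x => DFunLike.congr_fun hab x
  refine funext (Fintype.linearIndependent_iff.1 hli c ?_)
  funext x
  have h1 := LinearMap.congr_fun hT x
  simpa using h1

/-- A normal element modulo a maximal ideal with trivial inertia group. -/
theorem Ideal.exists_normal_mod {H R : Type*} [Group H] [Finite H] [CommRing R]
    [MulSemiringAction H R] (m : Ideal R) [m.IsMaximal]
    (hm : ∀ h : H, (∀ x : R, h • x - x ∈ m) → h = 1) :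
    ∃ θ : R, ∀ b : H → R, (∀ d ∈ MulAction.stabilizer H m,
      ∑ᶠ e : MulAction.stabilizer H m, ((d * e) • θ) * b e ∈ m) → b 1 ∈ m := by
  classical
  let _ : Field (R ⧸ m) := Ideal.Quotient.field m
  let D := MulAction.stabilizer H m
  let _ : Fintype D := Fintype.ofFinite D
  let φ := Ideal.Quotient.stabilizerHom m (m.under ℤ) H
  let _ : MulSemiringAction D (R ⧸ m) := MulSemiringAction.compHom (R ⧸ m) φ
  have hmk : ∀ (d : D) (x : R), d • (Ideal.Quotient.mk m x) = Ideal.Quotient.mk m ((d : H) • x) :=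
    fun d x => rfl
  have hfaith : FaithfulSMul D (R ⧸ m) := ⟨fun {a b} hab => by
    have h1 : a⁻¹ * b = 1 := by
      refine Subtype.ext (hm _ fun x => ?_)
      rw [← Ideal.Quotient.eq]
      rw [← hmk, mul_smul, ← hab, inv_smul_smul]
    exact inv_mul_eq_one.1 h1⟩
  obtain ⟨t, ht⟩ := exists_isUnit_of_smul D (R ⧸ m)
  obtain ⟨θ, rfl⟩ := Ideal.Quotient.mk_surjective t
  refine ⟨θ, fun b hb => ?_⟩
  have h1 := Matrix.mulVec_injective_of_isUnit ht
  have h2 : (fun e : D => Ideal.Quotient.mk m (b e)) = 0 := by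
    refine h1 ?_
    rw [Matrix.mulVec_zero]
    funext d
    have h3 := hb d d.2
    rw [finsum_eq_sum_of_fintype, ← Ideal.Quotient.eq_zero_iff_mem, map_sum] at h3
    simp only [map_mul] at h3
    exact h3
  exact Ideal.Quotient.eq_zero_iff_mem.1 (congrFun h2 1)

end NormalElement

section NormalElement

open scoped Pointwise

theorem exists_isUnit_of_smul_of_finite_maximalSpectrum {H R : Type*} [Group H] [Fintype H] [DecidableEq H]
    [CommRing R] [Finite (MaximalSpectrum R)] [MulSemiringAction H R]
    (hR : ∀ m : Ideal R, m.IsMaximal → ∀ h : H, (∀ x : R, h • x - x ∈ m) → h = 1) :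
    ∃ θ : R, IsUnit (Matrix.of fun g h : H => (g * h) • θ) := by
  classical
  have hmax : ∀ (h : H) (m : Ideal R), m.IsMaximal → (h • m).IsMaximal := fun h m hm =>
    Ideal.map_isMaximal_of_equiv (MulSemiringAction.toRingEquiv H R h) (hp := hm)
  let s : Setoid (MaximalSpectrum R) :=
    { r := fun m n => ∃ h : H, h • m.asIdeal = n.asIdeal
      iseqv := ⟨fun m => ⟨1, one_smul _ _⟩,
        fun ⟨h, e⟩ => ⟨h⁻¹, by rw [← e, inv_smul_smul]⟩,
        fun ⟨h, e⟩ ⟨h', e'⟩ => ⟨h' * h, by rw [mul_smul, e, e']⟩⟩ }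
  let rep : MaximalSpectrum R → MaximalSpectrum R := fun m => (Quotient.mk s m).out
  have hrep : ∀ m, ∃ h : H, h • (rep m).asIdeal = m.asIdeal := fun m => Quotient.mk_out (s := s) m
  have hrep_eq : ∀ m n : MaximalSpectrum R, (∃ h : H, h • m.asIdeal = n.asIdeal) → rep m = rep n :=
    fun m n h => congrArg Quotient.out (Quotient.sound (s := s) h)
  have hnorm := fun m : MaximalSpectrum R =>
    have := m.isMaximal
    Ideal.exists_normal_mod (H := H) m.asIdeal (hR m.asIdeal m.isMaximal)
  choose τ hτ using hnorm
  obtain ⟨θ, hθ⟩ := Ideal.exists_forall_sub_mem_ideal (I := fun m : MaximalSpectrum R => m.asIdeal)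
    (fun m n hmn => by
      have h1 := m.isMaximal
      have h2 := n.isMaximal
      exact Ideal.isCoprime_of_isMaximal fun h => hmn (MaximalSpectrum.ext h))
    (fun m => if rep m = m then τ m else 0)
  refine ⟨θ, ?_⟩
  rw [Matrix.isUnit_iff_isUnit_det]
  by_contra hdet
  obtain ⟨m, hm, hdm⟩ := exists_max_ideal_of_mem_nonunits hdet
  let _ : Field (R ⧸ m) := Ideal.Quotient.field m
  have hdet0 : ((Ideal.Quotient.mk m).mapMatrix
      (Matrix.of fun g h : H => (g * h) • θ)).det = 0 := by
    rw [← RingHom.map_det]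
    exact Ideal.Quotient.eq_zero_iff_mem.2 hdm
  obtain ⟨v, hv, hMv⟩ := Matrix.exists_mulVec_eq_zero_iff.2 hdet0
  choose a ha using fun h => Ideal.Quotient.mk_surjective (v h)
  obtain ⟨t, ht⟩ := hrep ⟨m, hm⟩
  set n := rep ⟨m, hm⟩ with hn
  have hrn : rep n = n := hrep_eq _ _ ⟨t, ht⟩
  have hkey : ∀ g : H, ∑ h, ((g * h) • θ) * (t⁻¹ • a h) ∈ n.asIdeal := by
    intro g
    have h1 : ∑ h, ((t * g * h) • θ) * a h ∈ m := by
      rw [← Ideal.Quotient.eq_zero_iff_mem, map_sum]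
      have h2 := congrFun hMv (t * g)
      simp only [Matrix.mulVec, dotProduct, ← ha] at h2
      simpa using h2
    have h2 : ∑ h, ((t * g * h) • θ) * a h = t • ∑ h, ((g * h) • θ) * (t⁻¹ • a h) := by
      rw [Finset.smul_sum]
      refine Finset.sum_congr rfl fun h _ => ?_
      rw [smul_mul', smul_inv_smul, smul_smul, mul_assoc]
    rw [h2] at h1
    rw [← Ideal.smul_mem_pointwise_smul_iff (a := t)]
    exact ht.symm ▸ h1
  refine hv (funext fun h₀ => ?_)
  have hmem : t⁻¹ • a h₀ ∈ n.asIdeal := by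
    have h1 := hτ n (fun e => t⁻¹ • a (h₀ * e)) fun d hd => ?_
    · simpa only [mul_one] using h1
    rw [finsum_eq_sum_of_fintype]
    have h2 := hkey (d * h₀⁻¹)
    rw [← Equiv.sum_comp (Equiv.mulLeft h₀)] at h2
    simp only [Equiv.coe_mulLeft, inv_mul_cancel_left, mul_assoc] at h2
    rw [← Fintype.sum_subtype_add_sum_subtype (fun e => e ∈ MulAction.stabilizer H n.asIdeal)] at h2
    have h3 : ∑ e : {e // e ∉ MulAction.stabilizer H n.asIdeal},
        ((d * e) • θ) * (t⁻¹ • a (h₀ * e)) ∈ n.asIdeal := by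
      refine sum_mem fun e _ => Ideal.mul_mem_right _ _ ?_
      have hne : (d * (e : H))⁻¹ • n.asIdeal ≠ n.asIdeal := fun h =>
        e.2 ((Subgroup.mul_mem_cancel_left _ hd).1 (inv_mem_iff.1 (MulAction.mem_stabilizer_iff.2 h)))
      let n' : MaximalSpectrum R := ⟨(d * (e : H))⁻¹ • n.asIdeal, hmax _ _ n.isMaximal⟩
      have hn' : rep n' = n := (hrep_eq n n' ⟨_, rfl⟩).symm.trans hrn
      have h4 := hθ n'
      rw [if_neg (by
        rw [hn']
        intro h
        exact hne (congrArg MaximalSpectrum.asIdeal h).symm), sub_zero] at h4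
      exact Ideal.mem_inv_pointwise_smul_iff.1 h4
    have h4 := (Ideal.add_mem_iff_left _ h3).1 h2
    have h5 : ∑ e : {e // e ∈ MulAction.stabilizer H n.asIdeal},
        ((d * e) • (θ - τ n)) * (t⁻¹ • a (h₀ * e)) ∈ n.asIdeal := by
      refine sum_mem fun e _ => Ideal.mul_mem_right _ _ ?_
      have h6 := hθ n
      rw [if_pos hrn] at h6
      have h7 := Ideal.smul_mem_pointwise_smul (d * (e : H)) _ _ h6
      rwa [MulAction.mem_stabilizer_iff.1 (mul_mem hd e.2)] at h7
    have h6 := sub_mem h4 h5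
    rw [← Finset.sum_sub_distrib] at h6
    convert h6 using 2 with e
    rw [smul_sub]
    ring
  rw [← Ideal.smul_mem_pointwise_smul_iff (a := t), smul_inv_smul, ht] at hmem
  rw [← ha]
  exact Ideal.Quotient.eq_zero_iff_mem.2 hmem

end NormalElement

section FreeRepresentation

variable {k G V : Type*} [Field k] [Group G] [Fintype G] [AddCommGroup V] [Module k V]

/-- The module of a representation is free over the group algebra, generated by a subspace. -/
def Representation.HasFreeGenerators (ρ : Representation k G V) : Prop :=
  ∃ W : Submodule k V, Function.Bijective fun f : G → W => ∑ g, ρ g (f g)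

theorem Representation.hasFreeGenerators_of_isUnit {R : Type*} [DecidableEq G] [CommRing R]
    [MulSemiringAction G R] [Module R V] [SMulCommClass R k V] (ρ : Representation k G V)
    (hρ : ∀ g (r : R) v, ρ g (r • v) = (g • r) • ρ g v) {θ : R}
    (hθ : IsUnit (Matrix.of fun g h : G => (g * h) • θ)) : ρ.HasFreeGenerators := by
  obtain ⟨N, hMN, hNM⟩ := isUnit_iff_exists.1 hθ
  have happly : ∀ g (w : G → V), (∀ h, w h ∈ ρ.invariants) →
      ρ g (∑ h, ρ h (θ • w h)) = ∑ h, ((g * h) • θ) • w h := by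
    intro g w hw
    rw [map_sum]
    refine Finset.sum_congr rfl fun h _ => ?_
    rw [← Module.End.mul_apply, ← map_mul, hρ, hw h]
  have huniq : ∀ w : G → V, (∀ g, ∑ h, ((g * h) • θ) • w h = 0) → ∀ l, w l = 0 := by
    intro w hw l
    have h1 : ∑ g, N l g • ∑ h, ((g * h) • θ) • w h = 0 :=
      Finset.sum_eq_zero fun g _ => by rw [hw, smul_zero]
    simp_rw [Finset.smul_sum, smul_smul] at h1
    rw [Finset.sum_comm] at h1
    simp_rw [← Finset.sum_smul] at h1
    have h2 : ∀ h, ∑ g, N l g * (g * h) • θ = (1 : Matrix G G R) l h := fun h => by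
      rw [← hNM, Matrix.mul_apply]
      rfl
    simp_rw [h2] at h1
    simpa [Matrix.one_apply] using h1
  refine ⟨ρ.invariants.map (DistribSMul.toLinearMap k V θ), ?_, fun v => ?_⟩
  · let Φ : (G → ρ.invariants.map (DistribSMul.toLinearMap k V θ)) →+ V :=
      { toFun := fun f => ∑ g, ρ g (f g)
        map_zero' := by simp
        map_add' := fun f f' => by simp [Finset.sum_add_distrib] }
    refine (injective_iff_map_eq_zero Φ).2 fun f hf => ?_
    choose w hw hwf using fun g => (Submodule.mem_map).1 (f g).2
    have hwf' : ∀ g, (f g : V) = θ • w g := fun g => (hwf g).symm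
    have hf' : ∑ g, ρ g (θ • w g) = 0 := by
      simp_rw [← hwf']
      exact hf
    have hw0 := huniq w fun g => by rw [← happly g w hw, hf', map_zero]
    funext g
    refine Subtype.ext ?_
    rw [hwf', hw0, smul_zero]
    rfl
  · let w : G → V := fun l => ∑ g, N l g • ρ g v
    have hw : ∀ g, ∑ h, ((g * h) • θ) • w h = ρ g v := by
      intro g
      simp_rw [w, Finset.smul_sum, smul_smul]
      rw [Finset.sum_comm]
      simp_rw [← Finset.sum_smul]
      have h2 : ∀ h, ∑ l, (g * l) • θ * N l h = (1 : Matrix G G R) g h := fun h => by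
        rw [← hMN, Matrix.mul_apply]
        rfl
      simp_rw [h2]
      simp [Matrix.one_apply]
    have hwinv : ∀ h, w h ∈ ρ.invariants := by
      intro h t
      rw [← sub_eq_zero]
      refine huniq (fun h => ρ t (w h) - w h) (fun g => ?_) h
      simp_rw [smul_sub]
      rw [Finset.sum_sub_distrib, hw, sub_eq_zero]
      have h1 := congrArg (ρ t) (hw (t⁻¹ * g))
      rw [← Module.End.mul_apply, ← map_mul, mul_inv_cancel_left, map_sum] at h1
      rw [← h1]
      refine Finset.sum_congr rfl fun h _ => ?_
      rw [hρ, smul_smul, ← mul_assoc, mul_inv_cancel_left]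
    refine ⟨fun h => ⟨θ • w h, Submodule.mem_map.2 ⟨w h, hwinv h, rfl⟩⟩, ?_⟩
    have h1 := happly 1 w hwinv
    rw [hw, map_one] at h1
    exact h1

theorem Representation.HasFreeGenerators.of_isCompl {ρ : Representation k G V}
    {U₁ U₂ : Submodule k V} (hU : IsCompl U₁ U₂) (h₁ : ∀ g, U₁ ≤ U₁.comap (ρ g))
    (h₂ : ∀ g, U₂ ≤ U₂.comap (ρ g)) (hf₁ : (ρ.subrepresentation U₁ h₁).HasFreeGenerators)
    (hf₂ : (ρ.subrepresentation U₂ h₂).HasFreeGenerators) : ρ.HasFreeGenerators := by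
  obtain ⟨W₁, hi₁, hs₁⟩ := hf₁
  obtain ⟨W₂, hi₂, hs₂⟩ := hf₂
  have hcoe₁ : ∀ f : G → W₁, ((∑ g, ρ.subrepresentation U₁ h₁ g (f g) : U₁) : V) =
      ∑ g, ρ g ((f g : U₁) : V) := fun f => by
    rw [AddSubmonoidClass.coe_finsetSum]
    rfl
  have hcoe₂ : ∀ f : G → W₂, ((∑ g, ρ.subrepresentation U₂ h₂ g (f g) : U₂) : V) =
      ∑ g, ρ g ((f g : U₂) : V) := fun f => by
    rw [AddSubmonoidClass.coe_finsetSum]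
    rfl
  refine ⟨W₁.map U₁.subtype ⊔ W₂.map U₂.subtype, ?_, fun v => ?_⟩
  · let Φ : (G → (W₁.map U₁.subtype ⊔ W₂.map U₂.subtype : Submodule k V)) →+ V :=
      { toFun := fun f => ∑ g, ρ g (f g)
        map_zero' := by simp
        map_add' := fun f f' => by simp [Finset.sum_add_distrib] }
    refine (injective_iff_map_eq_zero Φ).2 fun f hf => ?_
    have hdec : ∀ g, ∃ (a : W₁) (b : W₂), ((a : U₁) : V) + ((b : U₂) : V) = f g := by
      intro g
      obtain ⟨_, ⟨a, ha, rfl⟩, _, ⟨b, hb, rfl⟩, hab⟩ := Submodule.mem_sup.1 (f g).2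
      exact ⟨⟨a, ha⟩, ⟨b, hb⟩, hab⟩
    choose a b hab using hdec
    have hsum : ((∑ g, ρ.subrepresentation U₁ h₁ g (a g) : U₁) : V) +
        ((∑ g, ρ.subrepresentation U₂ h₂ g (b g) : U₂) : V) = 0 := by
      rw [hcoe₁, hcoe₂, ← Finset.sum_add_distrib]
      simp_rw [← map_add, hab]
      exact hf
    have hz : ∀ (x : U₁) (y : U₂), (x : V) + y = 0 → x = 0 ∧ y = 0 := by
      intro x y hxy
      have hx : (x : V) = 0 := by
        refine Submodule.disjoint_def.1 hU.disjoint x x.2 ?_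
        rw [eq_neg_of_add_eq_zero_left hxy]
        exact neg_mem y.2
      rw [hx, zero_add] at hxy
      exact ⟨Subtype.ext hx, Subtype.ext hxy⟩
    obtain ⟨ha, hb⟩ := hz _ _ hsum
    have ha0 : a = 0 := hi₁ (by simpa using ha)
    have hb0 : b = 0 := hi₂ (by simpa using hb)
    funext g
    refine Subtype.ext ?_
    rw [← hab, ha0, hb0]
    simp
  · obtain ⟨x, hx, y, hy, rfl⟩ := Submodule.mem_sup.1
      (hU.sup_eq_top ▸ Submodule.mem_top : v ∈ U₁ ⊔ U₂)
    obtain ⟨a, ha⟩ := hs₁ ⟨x, hx⟩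
    obtain ⟨b, hb⟩ := hs₂ ⟨y, hy⟩
    refine ⟨fun g => ⟨((a g : U₁) : V) + ((b g : U₂) : V), Submodule.add_mem_sup
      ⟨a g, (a g).2, rfl⟩ ⟨b g, (b g).2, rfl⟩⟩, ?_⟩
    simp only [map_add, Finset.sum_add_distrib]
    rw [← hcoe₁, ← hcoe₂]
    exact congrArg₂ (· + ·) (congrArg Subtype.val ha) (congrArg Subtype.val hb)

end FreeRepresentation

section FixedPointFreeAction

variable {k G V : Type*} [Field k] [Group G] [AddCommGroup V] [Module k V]

namespace Representation

theorem sum_eq_zero_of_invariants_eq_zero (ρ : Representation k G V) (K : Subgroup G) [Fintype K]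
    (hinv : ∀ v, (∀ x ∈ K, ρ x v = v) → v = 0) : ∑ x : K, ρ x = 0 := by
  refine LinearMap.ext fun v => hinv _ fun y hy => ?_
  rw [← Module.End.mul_apply, Finset.mul_sum]
  congr 1
  conv_rhs => rw [← Equiv.sum_comp (Equiv.mulLeft (⟨y, hy⟩ : K))]
  exact Finset.sum_congr rfl fun x _ => (map_mul ρ y x).symm

/-- The subalgebra of endomorphisms generated by the image of a subgroup. -/
def subgroupAlgebra (ρ : Representation k G V) (K : Subgroup G) :
    Subalgebra k (Module.End k V) :=
  Algebra.adjoin k (ρ '' K)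

theorem conj_mem_subgroupAlgebra (ρ : Representation k G V) (K : Subgroup G) [hK : K.Normal]
    (g : G) {r : Module.End k V} (hr : r ∈ ρ.subgroupAlgebra K) :
    ρ g * r * ρ g⁻¹ ∈ ρ.subgroupAlgebra K := by
  have hg : ρ g⁻¹ * ρ g = 1 := by rw [← map_mul, inv_mul_cancel, map_one]
  have hg' : ρ g * ρ g⁻¹ = 1 := by rw [← map_mul, mul_inv_cancel, map_one]
  induction hr using Algebra.adjoin_induction with
  | mem r hr =>
    obtain ⟨x, hx, rfl⟩ := hr
    rw [← map_mul, ← map_mul]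
    exact Algebra.subset_adjoin ⟨_, hK.conj_mem x hx g, rfl⟩
  | algebraMap c =>
    rw [← Algebra.commutes, mul_assoc, hg', mul_one]
    exact Subalgebra.algebraMap_mem _ c
  | add r s _ _ hr hs =>
    rw [mul_add, add_mul]
    exact add_mem hr hs
  | mul r s _ _ hr hs =>
    have : ρ g * (r * s) * ρ g⁻¹ = (ρ g * r * ρ g⁻¹) * (ρ g * s * ρ g⁻¹) := by
      simp only [mul_assoc]
      rw [← mul_assoc (ρ g⁻¹), hg, one_mul]
    rw [this]
    exact mul_mem hr hs

theorem bijective_inv_mul_conj {K : Subgroup G} [hK : K.Normal] [Finite K] {h : G}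
    (hh : ∀ x ∈ K, h * x * h⁻¹ = x → x = 1) :
    Function.Bijective fun x : K => x⁻¹ * ⟨h * x * h⁻¹, hK.conj_mem x x.2 h⟩ := by
  refine Finite.injective_iff_bijective.1 fun x y hxy => ?_
  have h1 : (x : G)⁻¹ * (h * x * h⁻¹) = (y : G)⁻¹ * (h * y * h⁻¹) := congrArg Subtype.val hxy
  have h2 : h * ((y : G) * (x : G)⁻¹) * h⁻¹ = (y : G) * (x : G)⁻¹ := by
    calc h * ((y : G) * (x : G)⁻¹) * h⁻¹ = y * ((y : G)⁻¹ * (h * y * h⁻¹)) * (h * x * h⁻¹)⁻¹ := by group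
      _ = (y : G) * (x : G)⁻¹ := by rw [← h1]; group
  exact (Subtype.ext (mul_inv_eq_one.1
    (hh _ (K.mul_mem y.2 (K.inv_mem x.2)) h2) : (y : G) = x)).symm

theorem hasFreeGenerators_of_commute [FiniteDimensional k V] (ρ : Representation k G V)
    (K H : Subgroup G) [hK : K.Normal] [Finite K] [Fintype H]
    (hKk : (Nat.card K : k) ≠ 0) (hfix : ∀ h ∈ H, h ≠ 1 → ∀ x ∈ K, h * x * h⁻¹ = x → x = 1)
    (hcomm : ∀ x ∈ K, ∀ y ∈ K, ρ x * ρ y = ρ y * ρ x)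
    (hinv : ∀ v, (∀ x ∈ K, ρ x v = v) → v = 0) : HasFreeGenerators (G := H) (ρ.comp H.subtype) := by
  classical
  let _ : Fintype K := Fintype.ofFinite K
  let R := ρ.subgroupAlgebra K
  have hRcomm : IsMulCommutative R := Algebra.isMulCommutative_adjoin k (by
    rintro _ ⟨x, hx, rfl⟩ _ ⟨y, hy, rfl⟩
    exact hcomm x hx y hy)
  let _ : CommRing R := { R.toRing with mul_comm := hRcomm.is_comm.comm }
  let _ : MulSemiringAction H R :=
    { smul := fun h r => ⟨ρ h * r * ρ (h : G)⁻¹, ρ.conj_mem_subgroupAlgebra K h r.2⟩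
      one_smul := fun r => Subtype.ext (by
        change ρ (1 : G) * r * ρ (1 : G)⁻¹ = r
        rw [inv_one, map_one, one_mul, mul_one])
      mul_smul := fun g h r => Subtype.ext (by
        change ρ (g * h : G) * r * ρ (g * h : G)⁻¹ = ρ g * (ρ h * r * ρ (h : G)⁻¹) * ρ (g : G)⁻¹
        rw [mul_inv_rev, map_mul, map_mul]
        simp only [mul_assoc])
      smul_zero := fun h => Subtype.ext (by
        change ρ h * 0 * ρ (h : G)⁻¹ = 0
        rw [mul_zero, zero_mul])
      smul_add := fun h r s => Subtype.ext (by
        change ρ h * (r + s) * ρ (h : G)⁻¹ = ρ h * r * ρ (h : G)⁻¹ + ρ h * s * ρ (h : G)⁻¹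
        rw [mul_add, add_mul])
      smul_one := fun h => Subtype.ext (by
        change ρ h * 1 * ρ (h : G)⁻¹ = 1
        rw [mul_one, ← map_mul, mul_inv_cancel, map_one])
      smul_mul := fun h r s => Subtype.ext (by
        change ρ h * (r * s) * ρ (h : G)⁻¹ = (ρ h * r * ρ (h : G)⁻¹) * (ρ h * s * ρ (h : G)⁻¹)
        have hg : ρ (h : G)⁻¹ * ρ h = 1 := by rw [← map_mul, inv_mul_cancel, map_one]
        simp only [mul_assoc]
        rw [← mul_assoc (ρ (h : G)⁻¹), hg, one_mul]) }
  have hart : IsArtinianRing R := IsArtinianRing.of_finite k R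
  let c : K → R := fun x => ⟨ρ x, Algebra.subset_adjoin ⟨x, x.2, rfl⟩⟩
  have hsum : ∑ x, c x = 0 := Subtype.ext (by
    rw [AddSubmonoidClass.coe_finsetSum]
    exact ρ.sum_eq_zero_of_invariants_eq_zero K hinv)
  have hinertia : ∀ m : Ideal R, m.IsMaximal → ∀ h : H, (∀ x : R, h • x - x ∈ m) → h = 1 := by
    intro m hm h hx
    by_contra hne
    have h1 : ∑ x, c x⁻¹ * (h • c x - c x) ∈ m :=
      sum_mem fun x _ => Ideal.mul_mem_left _ _ (hx _)
    have hbij := bijective_inv_mul_conj (K := K) (hfix h h.2 fun e => hne (Subtype.ext e))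
    have h2 : ∀ x, c x⁻¹ * (h • c x) = c (x⁻¹ * ⟨h * x * (h : G)⁻¹, hK.conj_mem x x.2 h⟩) :=
      fun x => Subtype.ext (by
        change ρ (x : G)⁻¹ * (ρ h * ρ x * ρ (h : G)⁻¹) = ρ ((x : G)⁻¹ * (h * x * (h : G)⁻¹))
        simp only [map_mul])
    have h3 : ∀ x, c x⁻¹ * c x = 1 := fun x => Subtype.ext (by
      change ρ (x : G)⁻¹ * ρ x = 1
      rw [← map_mul, inv_mul_cancel, map_one])
    simp only [mul_sub, h2, h3] at h1
    rw [Finset.sum_sub_distrib, hbij.sum_comp c, hsum, zero_sub, neg_mem_iff, Finset.sum_const,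
      Finset.card_univ, ← Nat.card_eq_fintype_card, nsmul_one] at h1
    refine hm.ne_top (Ideal.eq_top_of_isUnit_mem _ h1 ?_)
    have h4 := (IsUnit.mk0 _ hKk).map (algebraMap k R)
    rwa [map_natCast] at h4
  obtain ⟨θ, hθ⟩ := exists_isUnit_of_smul_of_finite_maximalSpectrum (H := H) (R := R) hinertia
  refine hasFreeGenerators_of_isUnit (R := R) (ρ.comp H.subtype) (fun h r v => ?_) hθ
  change ρ h ((r : Module.End k V) v) = (ρ h * r * ρ (h : G)⁻¹) (ρ h v)
  simp only [Module.End.mul_apply]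
  rw [← Module.End.mul_apply (ρ (h : G)⁻¹), ← map_mul, inv_mul_cancel, map_one]
  rfl

end Representation

end FixedPointFreeAction

section FrobeniusAction

namespace Representation

variable {k G : Type*} [Field k] [Group G]

theorem HasFreeGenerators.of_forall_eq_zero {V : Type*} [AddCommGroup V] [Module k V] [Fintype G]
    (ρ : Representation k G V) (hV : ∀ v : V, v = 0) : ρ.HasFreeGenerators :=
  have : Subsingleton V := ⟨fun v w => (hV v).trans (hV w).symm⟩
  ⟨⊤, fun _ _ _ => Subsingleton.elim _ _, fun _ => ⟨0, Subsingleton.elim _ _⟩⟩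

theorem apply_comm_of_commutator {V : Type*} [AddCommGroup V] [Module k V]
    (ρ : Representation k G V) {K : Subgroup G} {v : V} (hv : ∀ z ∈ ⁅K, K⁆, ρ z v = v)
    {x y : G} (hx : x ∈ K) (hy : y ∈ K) : ρ (x * y) v = ρ (y * x) v := by
  have h1 : x * y = y * x * (x⁻¹ * y⁻¹ * x⁻¹⁻¹ * y⁻¹⁻¹) := by group
  rw [h1, map_mul ρ (y * x), Module.End.mul_apply]
  exact congrArg (ρ (y * x))
    (hv _ (Subgroup.commutator_mem_commutator (K.inv_mem hx) (K.inv_mem hy)))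

theorem isCompl_invariants_ker {V : Type*} [AddCommGroup V] [Module k V]
    (ρ : Representation k G V) [Fintype G] (hG : (Nat.card G : k) ≠ 0) :
    IsCompl ρ.invariants (LinearMap.ker (∑ g, ρ g)) := by
  have hT : ∀ v ∈ ρ.invariants, (∑ g, ρ g) v = (Nat.card G : k) • v := by
    intro v hv
    rw [LinearMap.sum_apply, Finset.sum_congr rfl fun g _ => hv g, Finset.sum_const,
      Finset.card_univ, ← Nat.card_eq_fintype_card, Nat.cast_smul_eq_nsmul]
  have hinv : ∀ v, (∑ g, ρ g) v ∈ ρ.invariants := by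
    intro v g
    rw [← Module.End.mul_apply, Finset.mul_sum]
    congr 1
    conv_rhs => rw [← Equiv.sum_comp (Equiv.mulLeft g)]
    exact Finset.sum_congr rfl fun x _ => (map_mul ρ g x).symm
  constructor
  · rw [Submodule.disjoint_def]
    intro v hv hv'
    rw [LinearMap.mem_ker, hT v hv] at hv'
    exact (smul_eq_zero.1 hv').resolve_left hG
  · rw [codisjoint_iff, eq_top_iff]
    intro v _
    refine Submodule.mem_sup.2 ⟨(Nat.card G : k)⁻¹ • (∑ g, ρ g) v,
      Submodule.smul_mem _ _ (hinv v), v - (Nat.card G : k)⁻¹ • (∑ g, ρ g) v, ?_, by abel⟩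
    rw [LinearMap.mem_ker, map_sub, map_smul, hT _ (hinv v), inv_smul_smul₀ hG, sub_self]

theorem hasFreeGenerators_of_isSolvable (H : Subgroup G) [Fintype H] (K : Subgroup G)
    [hK : K.Normal] [Finite K] [Group.IsSolvable K] (hKk : (Nat.card K : k) ≠ 0)
    (hfix : ∀ h ∈ H, h ≠ 1 → ∀ x ∈ K, h * x * h⁻¹ = x → x = 1)
    (V : Type*) [AddCommGroup V] [Module k V] [FiniteDimensional k V] (ρ : Representation k G V)
    (hinv : ∀ v, (∀ x ∈ K, ρ x v = v) → v = 0) :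
    HasFreeGenerators (G := H) (ρ.comp H.subtype) := by
  induction hn : Nat.card K using Nat.strong_induction_on generalizing K V with
  | _ n ih =>
  subst hn
  by_cases hbot : K = ⊥
  · subst hbot
    exact .of_forall_eq_zero _ fun v => hinv v fun x hx => by
      rw [Subgroup.mem_bot.1 hx, map_one]; rfl
  let L : Subgroup G := ⁅K, K⁆
  have hLK : L ≤ K := Subgroup.commutator_le_left K K
  have hlt : L < K := by
    have hnt : Nontrivial K := (Subgroup.nontrivial_iff_ne_bot _).2 hbot
    refine lt_of_le_of_ne hLK fun e => (Group.IsSolvable.commutator_lt_top_of_nontrivial K).ne ?_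
    refine Subgroup.map_injective K.subtype_injective ?_
    rw [Subgroup.map_subtype_commutator, ← MonoidHom.range_eq_map, Subgroup.range_subtype]
    exact e
  have hLfin : Finite L := Finite.of_injective _ (Subgroup.inclusion_injective hLK)
  let _ : Fintype L := Fintype.ofFinite L
  have hLsol : Group.IsSolvable L :=
    Group.isSolvable_of_isSolvable_injective (Subgroup.inclusion_injective hLK)
  have hLn : L.Normal := Subgroup.commutator_normal K K
  have hLk : (Nat.card L : k) ≠ 0 := fun h0 => hKk (by
    obtain ⟨c, hc⟩ := Subgroup.card_dvd_of_le hLK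
    rw [hc, Nat.cast_mul, h0, zero_mul])
  let ρL : Representation k L V := ρ.comp L.subtype
  have hcompl := ρL.isCompl_invariants_ker hLk
  have h₁ : ∀ g, ρL.invariants ≤ ρL.invariants.comap (ρ g) := by
    intro g v hv x
    change ρ x (ρ g v) = ρ g v
    have h1 := hv ⟨g⁻¹ * x * g⁻¹⁻¹, hLn.conj_mem x x.2 g⁻¹⟩
    change ρ (g⁻¹ * x * g⁻¹⁻¹) v = v at h1
    conv_rhs => rw [← h1]
    rw [← Module.End.mul_apply, ← Module.End.mul_apply, ← map_mul, ← map_mul]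
    congr 2
    group
  have h₂ : ∀ g, LinearMap.ker (∑ x, ρL x) ≤ (LinearMap.ker (∑ x, ρL x)).comap (ρ g) := by
    intro g v hv
    rw [Submodule.mem_comap, LinearMap.mem_ker, ← Module.End.mul_apply]
    have h1 : (∑ x, ρL x) * ρ g = ρ g * ∑ x, ρL x := by
      rw [Finset.mul_sum, Finset.sum_mul]
      rw [← Equiv.sum_comp (MulAut.conjNormal g : MulAut L).toEquiv]
      refine Finset.sum_congr rfl fun x _ => ?_
      change ρ ((MulAut.conjNormal g x : L) : G) * ρ g = ρ g * ρ x
      rw [MulAut.conjNormal_apply, ← map_mul, ← map_mul, inv_mul_cancel_right]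
    rw [h1, Module.End.mul_apply, LinearMap.mem_ker.1 hv, map_zero]
  refine HasFreeGenerators.of_isCompl (G := H) (ρ := ρ.comp H.subtype) hcompl (fun h => h₁ h)
    (fun h => h₂ h) ?_ ?_
  · refine hasFreeGenerators_of_commute (ρ.subrepresentation _ h₁) K H hKk hfix ?_ ?_
    · intro x hx y hy
      rw [← map_mul, ← map_mul]
      exact LinearMap.ext fun v => Subtype.ext
        (ρ.apply_comm_of_commutator (fun z hz => v.2 ⟨z, hz⟩) hx hy)
    · exact fun v hv => Subtype.ext (hinv v fun x hx => congrArg Subtype.val (hv x hx))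
  · refine ih _ (Set.ncard_lt_ncard hlt) L hLk (fun h hh hh1 x hx => hfix h hh hh1 x (hLK hx))
      (LinearMap.ker (∑ x, ρL x)) (ρ.subrepresentation _ h₂) (fun v hv => ?_) rfl
    refine Subtype.ext (Submodule.disjoint_def.1 hcompl.disjoint v (fun x => ?_) v.2)
    exact congrArg Subtype.val (hv x x.2)

theorem eq_zero_of_isPGroup {P V : Type*} [Group P] [Finite P] [AddCommGroup V] [Module k V]
    {p : ℕ} [hp : Fact p.Prime] [CharP k p] (hP : IsPGroup p P) (ρ : Representation k P V)
    (hinv : ∀ v, (∀ g, ρ g v = v) → v = 0) (v : V) : v = 0 := by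
  by_contra hv
  have hpV : ∀ w : V, p • w = 0 := fun w => by
    rw [← Nat.cast_smul_eq_nsmul k, CharP.cast_eq_zero, zero_smul]
  let A : AddSubgroup V := AddSubgroup.closure (Set.range fun g => ρ g v)
  have hA : ∀ g, ∀ w ∈ A, ρ g w ∈ A := by
    intro g w hw
    induction hw using AddSubgroup.closure_induction with
    | mem w hw =>
      obtain ⟨x, rfl⟩ := hw
      refine AddSubgroup.subset_closure ⟨g * x, ?_⟩
      exact LinearMap.congr_fun (map_mul ρ g x) v
    | zero => rw [map_zero]; exact A.zero_mem
    | add a b _ _ ha hb => rw [map_add]; exact A.add_mem ha hb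
    | neg a _ ha => rw [map_neg]; exact A.neg_mem ha
  have hfg : AddGroup.FG A := (AddGroup.fg_iff_addSubgroup_fg A).2
    ⟨(Set.finite_range fun g => ρ g v).toFinset, by rw [Set.Finite.coe_toFinset]⟩
  have hAp : ∀ a : A, p • a = 0 := fun a => Subtype.ext (hpV a)
  have hfin : Finite A := AddCommGroup.finite_of_fg_isAddTorsion A fun a =>
    isOfFinAddOrder_iff_nsmul_eq_zero.2 ⟨p, hp.out.pos, hAp a⟩
  let _ : MulAction P A :=
    { smul := fun g a => ⟨ρ g a, hA g a a.2⟩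
      one_smul := fun a => Subtype.ext (by change ρ 1 (a : V) = a; rw [map_one]; rfl)
      mul_smul := fun g h a => Subtype.ext (by
        change ρ (g * h) (a : V) = ρ g (ρ h a); rw [map_mul]; rfl) }
  have hvA : v ∈ A := AddSubgroup.subset_closure ⟨1, by simp⟩
  have hdvd : p ∣ Nat.card A := by
    rw [← addOrderOf_eq_prime (hAp ⟨v, hvA⟩) fun h => hv (congrArg Subtype.val h)]
    exact addOrderOf_dvd_natCard _
  obtain ⟨b, hb, hb0⟩ := hP.exists_fixed_point_of_prime_dvd_card_of_fixed_point A hdvd (a := 0)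
    fun g => Subtype.ext (map_zero (ρ g))
  exact hb0 (Subtype.ext (hinv b fun g => congrArg Subtype.val (hb g))).symm

theorem eq_zero_of_isPNilpotent {V : Type*} [AddCommGroup V] [Module k V] [Finite G]
    {p : ℕ} (hp : p.Prime) [CharP k p] (h : IsPNilpotent p G) (ρ : Representation k G V)
    (hinv : ∀ v, (∀ g, ρ g v = v) → v = 0) (v : V) (hv : ∀ g ∈ h.complement, ρ g v = v) :
    v = 0 := by
  have := Fact.mk hp
  have h1 := eq_zero_of_isPGroup (k := k) (h.isPGroup_quotient hp)
    (ρ.quotientToInvariants h.complement) (fun w hw => Subtype.ext (hinv w fun g =>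
      congrArg Subtype.val (hw g))) ⟨v, fun g => hv g g.2⟩
  exact congrArg Subtype.val h1

theorem hasFreeGenerators_of_frobenius {V : Type*} [AddCommGroup V] [Module k V]
    [FiniteDimensional k V] [Finite G] (ρ : Representation k G V) (F H : Subgroup G) [Fintype H]
    [hF : F.Normal] (hfix : ∀ h ∈ H, h ≠ 1 → ∀ x ∈ F, h * x * h⁻¹ = x → x = 1)
    (hinv : ∀ v, (∀ x ∈ F, ρ x v = v) → v = 0) :
    HasFreeGenerators (G := H) (ρ.comp H.subtype) := by
  by_cases hH : Nat.card H = 1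
  · have := (Nat.card_eq_one_iff_unique.1 hH).1
    let _ : Unique H := ⟨⟨1⟩, fun h => Subsingleton.elim _ _⟩
    have h1 : ∀ (f : H → (⊤ : Submodule k V)), ∑ h, (ρ.comp H.subtype) h (f h) = f 1 := by
      intro f
      rw [Fintype.sum_unique]
      change (ρ.comp H.subtype) 1 (f 1) = f 1
      rw [map_one]
      rfl
    refine ⟨⊤, fun f f' hff => funext fun h => Subtype.ext ?_, fun v => ⟨fun _ => ⟨v, Submodule.mem_top⟩, ?_⟩⟩
    · rw [Subsingleton.elim h 1, ← h1, ← h1]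
      exact hff
    · exact h1 _
  obtain ⟨r, hr, hrH⟩ := Nat.exists_prime_and_dvd hH
  have := Fact.mk hr
  obtain ⟨h, hh⟩ := exists_prime_orderOf_dvd_card' r hrH
  have hpow : ((h : G)) ^ r = 1 := by
    rw [← hh]
    exact congrArg Subtype.val (pow_orderOf_eq_one h)
  have hh1 : (h : G) ≠ 1 := fun e => by
    rw [show h = 1 from Subtype.ext e, orderOf_one] at hh
    exact hr.one_lt.ne hh
  let σ : F →* F := (MulAut.conjNormal (h : G) : MulAut F).toMonoidHom
  have hσi : ∀ (n : ℕ) (x : F), σ^[n] x = MulAut.conjNormal ((h : G) ^ n) x := by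
    intro n x
    induction n with
    | zero => simp
    | succ n ihn =>
      rw [Function.iterate_succ_apply', ihn, pow_succ', map_mul]
      rfl
  have hnil : ∀ p, p.Prime → IsPNilpotent p F := isPNilpotent_of_fixedPointFree hr F σ
    (fun x hx => Subtype.ext (hfix h h.2 hh1 x x.2 (congrArg Subtype.val hx)))
    (fun x => by rw [hσi, hpow, map_one]; rfl)
  have hsol := isSolvable_of_forall_isPNilpotent F hnil
  obtain ⟨p, hp⟩ := CharP.exists k
  obtain hprime | rfl := CharP.char_is_prime_or_zero k p
  · have := Fact.mk hprime
    let N := hnil p hprime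
    let K : Subgroup G := N.complement.map F.subtype
    have hKF : K ≤ F := Subgroup.map_subtype_le _
    have hK : K.Normal := ⟨by
      rintro _ ⟨x, hx, rfl⟩ g
      exact ⟨MulAut.conjNormal g x, IsPRegular.map hx (MulAut.conjNormal g : MulAut F).toMonoidHom,
        MulAut.conjNormal_apply g x⟩⟩
    have hKs : Group.IsSolvable K :=
      Group.isSolvable_of_isSolvable_injective (Subgroup.inclusion_injective hKF)
    refine hasFreeGenerators_of_isSolvable H K ?_ (fun h hh hh1 x hx => hfix h hh hh1 x (hKF hx))
      V ρ fun v hv => ?_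
    · rw [Ne, CharP.cast_eq_zero_iff k p]
      exact (Nat.Prime.coprime_iff_not_dvd hprime).1 (coprime_card_of_isPRegular (p := p) (by
        rintro _ ⟨x, hx, rfl⟩
        exact isPRegular_coe.2 hx)).symm
    · exact eq_zero_of_isPNilpotent hprime N (ρ.comp F.subtype)
        (fun w hw => hinv w fun x hx => hw ⟨x, hx⟩) v fun g hg => hv g ⟨g, hg, rfl⟩
  · have := CharP.charP_to_charZero k
    exact hasFreeGenerators_of_isSolvable H F (Nat.cast_ne_zero.2 Nat.card_pos.ne') hfix V ρ hinv

end Representation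

end FrobeniusAction

/-- If a Frobenius group FH with kernel F and complement H acts by linear
transformations on a finite-dimensional vector space V over a field k with
C_V(F) = 0, then V is a free kH-module: there is a k-subspace W such that the
map (H → W) → V, f ↦ ∑_{h∈H} h • f(h), is bijective (i.e. V ≅ kH ⊗ W). -/
theorem stmt_2 {k : Type*} [Field k] {V : Type*} [AddCommGroup V] [Module k V]
    [FiniteDimensional k V]
    {G : Type*} [Group G] [Fintype G] [DistribMulAction G V] [SMulCommClass G k V]
    (F H : Subgroup G) [Fintype H]
    (hFN : F.Normal) (hcompl : Subgroup.IsComplement' F H)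
    (hfrob : ∀ h ∈ H, h ≠ 1 → ∀ f ∈ F, h * f * h⁻¹ = f → f = 1)
    (hCVF : ∀ v : V, (∀ f ∈ F, f • v = v) → v = 0) :
    ∃ W : Submodule k V,
      Function.Bijective (fun f : (H → W) => ∑ h : H, (h : G) • (f h : V)) :=
  Representation.hasFreeGenerators_of_frobenius (Representation.ofDistribMulAction k G V) F H
    hfrob hCVF
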